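/- arXiv:2512.13450 — 14 statements merged into one kernel-verified Lean document; each statement's English description precedes it below -/
import Mathlib

section
/- For every odd positive integer p and every integer m, one has (-1)^{⌊m/p⌋} = (1/p) · Σ_{n=1, n odd}^{2p-1} sin(πn(2m+1)/(2p)) / sin(πn/(2p)), where the sum runs over the odd integers n with 1 ≤ n ≤ 2p-1. -/
open Real Finset

lemma aux_tele (x : ℝ) (p : ℕ) :
    (∑ k ∈ range p, 2 * Real.cos ((2 * k + 1) * x)) * Real.sin x = Real.sin (2 * p * x) := by
  induction p with
  | zero => simp
  | succ q ih =>
    rw [Finset.sum_range_succ, add_mul, ih]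
    have h1 : (2 * (q : ℝ) * x) = (2 * q + 1) * x - x := by ring
    have h2 : (2 * ((q + 1 : ℕ) : ℝ) * x) = (2 * q + 1) * x + x := by push_cast; ring
    rw [h1, h2, Real.sin_add, Real.sin_sub]
    ring

lemma aux_sum (p : ℕ) (f : ℕ → ℝ) :
    ∑ n ∈ (Finset.Icc 1 (2 * p - 1)).filter (fun n => Odd n), f n
      = ∑ k ∈ range p, f (2 * k + 1) := by
  symm
  refine Finset.sum_bij (fun k _ => 2 * k + 1) ?_ ?_ ?_ ?_
  · intro a ha
    simp only [Finset.mem_range, Finset.mem_filter, Finset.mem_Icc] at *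
    exact ⟨by omega, a, rfl⟩
  · intro a _ b _ h
    simpa using h
  · intro b hb
    simp only [Finset.mem_filter, Finset.mem_Icc] at hb
    obtain ⟨hb, k, rfl⟩ := hb
    exact ⟨k, by simp only [Finset.mem_range]; omega, rfl⟩
  · intros; rfl

lemma aux_ne (p k : ℕ) (hk : k < p) : Real.sin (π * ((2 * k + 1 : ℕ) : ℝ) / (2 * p)) ≠ 0 := by
  have hp : (0 : ℝ) < p := by exact_mod_cast (by omega : 0 < p)
  have h : ((2 * k + 1 : ℕ) : ℝ) < 2 * p := by exact_mod_cast (by omega : 2 * k + 1 < 2 * p)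
  apply ne_of_gt
  apply Real.sin_pos_of_pos_of_lt_pi
  · positivity
  · rw [div_lt_iff₀ (by positivity)]
    exact mul_lt_mul_of_pos_left h Real.pi_pos

lemma aux_cos (p : ℕ) (hp0 : 0 < p) (m : ℤ) :
    ∑ k ∈ range p, 2 * Real.cos ((2 * k + 1) * (π * (m + 1) / p))
      = p * ((-1 : ℝ) ^ ((m + 1) / (p : ℤ)) - (-1 : ℝ) ^ (m / (p : ℤ))) := by
  have hp : (p : ℝ) ≠ 0 := by positivity
  have hpz : (0 : ℤ) < p := by exact_mod_cast hp0
  by_cases hd : (p : ℤ) ∣ m + 1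
  · obtain ⟨j, hj⟩ := hd
    have e1 : (m + 1) / (p : ℤ) = j := by rw [hj]; exact Int.mul_ediv_cancel_left _ hpz.ne'
    have e2 : m / (p : ℤ) = j - 1 := by
      rw [Int.ediv_eq_iff_of_pos hpz]
      constructor <;> nlinarith
    have hc : ∀ k ∈ range p, 2 * Real.cos ((2 * k + 1) * (π * (m + 1) / p)) = 2 * (-1 : ℝ) ^ j := by
      intro k _
      have : ((m : ℝ) + 1) = p * j := by exact_mod_cast hj
      have h2 : (2 * (k : ℝ) + 1) * (π * (m + 1) / p) = (j : ℝ) * π + ((k * j : ℤ) : ℝ) * (2 * π) := by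
        rw [this]; push_cast; field_simp; ring
      rw [h2, Real.cos_add_int_mul_two_pi, Real.cos_int_mul_pi]
    rw [Finset.sum_congr rfl hc, e1, e2, zpow_sub_one₀ (by norm_num)]
    rw [Finset.sum_const, Finset.card_range, nsmul_eq_mul, inv_neg_one]
    ring
  · have e : (m + 1) / (p : ℤ) = m / (p : ℤ) := by
      have h1 := Int.emod_add_mul_ediv m p
      have h2 := Int.emod_nonneg m hpz.ne'
      have h3 := Int.emod_lt_of_pos m hpz
      rw [Int.ediv_eq_iff_of_pos hpz]
      constructor
      · nlinarith
      · have : m % p + 1 ≠ p := by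
          intro h
          exact hd ⟨m / p + 1, by linarith⟩
        have : m % p + 1 < p := by omega
        nlinarith
    rw [e, sub_self, mul_zero]
    have ht := aux_tele (π * (m + 1) / p) p
    have h0 : 2 * (p : ℝ) * (π * (m + 1) / p) = ((2 * (m + 1) : ℤ) : ℝ) * π := by
      push_cast; field_simp
    rw [h0, Real.sin_int_mul_pi] at ht
    rcases mul_eq_zero.1 ht with h | h
    · exact h
    · exfalso
      rw [Real.sin_eq_zero_iff] at h
      obtain ⟨n, hn⟩ := h
      apply hd
      refine ⟨n, ?_⟩
      have : ((m : ℝ) + 1) = p * n := by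
        field_simp at hn
        have := Real.pi_pos.ne'
        linarith
      exact_mod_cast this

lemma aux_step (p : ℕ) (hp0 : 0 < p) (m : ℤ) :
    (∑ k ∈ range p, Real.sin (π * ((2 * k + 1 : ℕ) : ℝ) * (2 * ((m + 1 : ℤ) : ℝ) + 1) / (2 * p))
        / Real.sin (π * ((2 * k + 1 : ℕ) : ℝ) / (2 * p)))
    - (∑ k ∈ range p, Real.sin (π * ((2 * k + 1 : ℕ) : ℝ) * (2 * (m : ℝ) + 1) / (2 * p))
        / Real.sin (π * ((2 * k + 1 : ℕ) : ℝ) / (2 * p)))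
      = p * ((-1 : ℝ) ^ ((m + 1) / (p : ℤ)) - (-1 : ℝ) ^ (m / (p : ℤ))) := by
  rw [← aux_cos p hp0 m, ← Finset.sum_sub_distrib]
  refine Finset.sum_congr rfl fun k hk => ?_
  have hne := aux_ne p k (Finset.mem_range.1 hk)
  have hp : (p : ℝ) ≠ 0 := by positivity
  rw [← sub_div, div_eq_iff hne]
  have h1 : π * ((2 * k + 1 : ℕ) : ℝ) * (2 * ((m + 1 : ℤ) : ℝ) + 1) / (2 * p)
      = (2 * k + 1) * (π * (m + 1) / p) + π * ((2 * k + 1 : ℕ) : ℝ) / (2 * p) := by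
    push_cast; field_simp
  have h2 : π * ((2 * k + 1 : ℕ) : ℝ) * (2 * (m : ℝ) + 1) / (2 * p)
      = (2 * k + 1) * (π * (m + 1) / p) - π * ((2 * k + 1 : ℕ) : ℝ) / (2 * p) := by
    push_cast; field_simp; ring
  rw [h1, h2, Real.sin_add, Real.sin_sub]
  ring

lemma aux_main (p : ℕ) (hp0 : 0 < p) (m : ℤ) :
    (∑ k ∈ range p, Real.sin (π * ((2 * k + 1 : ℕ) : ℝ) * (2 * (m : ℝ) + 1) / (2 * p))
        / Real.sin (π * ((2 * k + 1 : ℕ) : ℝ) / (2 * p)))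
      = p * (-1 : ℝ) ^ (m / (p : ℤ)) := by
  induction m using Int.induction_on with
  | zero =>
    have : ∀ k ∈ range p, Real.sin (π * ((2 * k + 1 : ℕ) : ℝ) * (2 * ((0 : ℤ) : ℝ) + 1) / (2 * p))
        / Real.sin (π * ((2 * k + 1 : ℕ) : ℝ) / (2 * p)) = 1 := by
      intro k hk
      have hne := aux_ne p k (Finset.mem_range.1 hk)
      rw [Int.cast_zero, mul_zero, zero_add, mul_one, div_self hne]
    rw [Finset.sum_congr rfl this]
    simp
  | succ i ih =>
    have := aux_step p hp0 i
    linarith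
  | pred i ih =>
    have := aux_step p hp0 (-(i : ℤ) - 1)
    rw [sub_add_cancel] at this
    linarith

/-- For every odd positive integer `p` and every integer `m`,
`(-1)^⌊m/p⌋ = (1/p) · Σ_{n=1, n odd}^{2p-1} sin(πn(2m+1)/(2p)) / sin(πn/(2p))`. -/
theorem stmt_0 (p : ℕ) (hp : Odd p) (hp0 : 0 < p) (m : ℤ) :
    (-1 : ℝ) ^ ⌊(m : ℝ) / (p : ℝ)⌋ =
      (1 / (p : ℝ)) *
        ∑ n ∈ (Finset.Icc 1 (2 * p - 1)).filter (fun n => Odd n),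
          Real.sin (π * n * (2 * (m : ℝ) + 1) / (2 * p)) / Real.sin (π * n / (2 * p)) := by
  have hpr : (p : ℝ) ≠ 0 := by positivity
  have hpz : (0 : ℤ) < p := by exact_mod_cast hp0
  have hf : ⌊(m : ℝ) / (p : ℝ)⌋ = m / (p : ℤ) := by
    have hpp : (0 : ℝ) < p := by positivity
    rw [Int.floor_eq_iff, le_div_iff₀ hpp, div_lt_iff₀ hpp]
    constructor
    · exact_mod_cast Int.ediv_mul_le m hpz.ne'
    · exact_mod_cast Int.lt_ediv_add_one_mul_self m hpz
  rw [aux_sum p (fun n => Real.sin (π * n * (2 * (m : ℝ) + 1) / (2 * p)) / Real.sin (π * n / (2 * p))),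
    aux_main p hp0 m, hf]
  field_simp
end

section
/- Let p ≥ 3 be an odd integer and let X, Y, Z be nonzero complex numbers that are pairwise distinct and satisfy XY ≠ 1, XZ ≠ 1, YZ ≠ 1. Then F_p(X,Y,Z) = XYZ · [ 1/((1-XY)(1-XZ)(1-YZ)) + X^p Y^p/((XY-1)(X-Z)(Y-Z)) + Y^p Z^p/((YZ-1)(Y-X)(Z-X)) + X^p Z^p/((XZ-1)(X-Y)(Z-Y)) ]. -/
open Finset

/-- For an odd integer `p > 1`, `T_p` is the set of triples `(j,k,ℓ)` of integers with
`0 ≤ j,k,ℓ ≤ p-2`, `j+k+ℓ` even, `j+k+ℓ ≤ 2p-4`, `ℓ ≤ j+k`, `j ≤ k+ℓ`, `k ≤ j+ℓ`,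
and `F_p(X,Y,Z) = Σ_{(j,k,ℓ) ∈ T_p} X^{j+1} Y^{k+1} Z^{ℓ+1}`. -/
noncomputable def Fp (p : ℕ) (X Y Z : ℂ) : ℂ :=
  ∑ t ∈ (Finset.range (p - 1) ×ˢ Finset.range (p - 1) ×ˢ Finset.range (p - 1)).filter
      (fun t => Even (t.1 + t.2.1 + t.2.2) ∧ t.1 + t.2.1 + t.2.2 + 4 ≤ 2 * p ∧
        t.2.2 ≤ t.1 + t.2.1 ∧ t.1 ≤ t.2.1 + t.2.2 ∧ t.2.1 ≤ t.1 + t.2.2),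
    X ^ (t.1 + 1) * Y ^ (t.2.1 + 1) * Z ^ (t.2.2 + 1)

lemma H1_closed (u : ℂ) (hu : u ≠ 1) (n : ℕ) :
    ∑ a ∈ range (n + 1), u ^ a = (u ^ (n + 1) - 1) / (u - 1) :=
  geom_sum_eq hu (n + 1)

lemma H_step (v : ℂ) (f : ℕ → ℂ) (n : ℕ) :
    ∑ b ∈ range (n + 1 + 1), v ^ b * f (n + 1 - b)
      = f (n + 1) + v * ∑ b ∈ range (n + 1), v ^ b * f (n - b) := by
  rw [Finset.sum_range_succ', Finset.mul_sum, add_comm]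
  simp only [pow_zero, one_mul, Nat.sub_zero, Nat.add_sub_add_right]
  congr 1
  exact Finset.sum_congr rfl fun b _ => by ring

lemma H2_closed (u v : ℂ) (hu : u ≠ 1) (hv : v ≠ 1) (huv : u ≠ v) (n : ℕ) :
    ∑ b ∈ range (n + 1), v ^ b * ∑ a ∈ range (n - b + 1), u ^ a
      = 1 / ((1 - u) * (1 - v)) + u ^ (n + 2) / ((u - 1) * (u - v))
        + v ^ (n + 2) / ((v - 1) * (v - u)) := by
  have h1 : u - 1 ≠ 0 := sub_ne_zero.2 hu
  have h1' : 1 - u ≠ 0 := sub_ne_zero.2 hu.symm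
  have h2 : v - 1 ≠ 0 := sub_ne_zero.2 hv
  have h2' : 1 - v ≠ 0 := sub_ne_zero.2 hv.symm
  have h3 : u - v ≠ 0 := sub_ne_zero.2 huv
  have h3' : v - u ≠ 0 := sub_ne_zero.2 huv.symm
  rw [← neg_sub u 1, ← neg_sub v 1, ← neg_sub u v]
  induction n with
  | zero => simp; field_simp; ring
  | succ n ih =>
    rw [H_step v (fun m => ∑ a ∈ range (m + 1), u ^ a), ih, H1_closed u hu]
    field_simp
    ring

lemma H3_closed (u v w : ℂ) (hu : u ≠ 1) (hv : v ≠ 1) (hw : w ≠ 1) (huv : u ≠ v)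
    (huw : u ≠ w) (hvw : v ≠ w) (n : ℕ) :
    ∑ c ∈ range (n + 1), w ^ c * ∑ b ∈ range (n - c + 1), v ^ b *
        ∑ a ∈ range (n - c - b + 1), u ^ a
      = 1 / ((1 - u) * (1 - v) * (1 - w)) + u ^ (n + 3) / ((u - 1) * (u - v) * (u - w))
        + v ^ (n + 3) / ((v - 1) * (v - u) * (v - w))
        + w ^ (n + 3) / ((w - 1) * (w - u) * (w - v)) := by
  have h1 : u - 1 ≠ 0 := sub_ne_zero.2 hu
  have h2 : v - 1 ≠ 0 := sub_ne_zero.2 hv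
  have h3 : w - 1 ≠ 0 := sub_ne_zero.2 hw
  have h4 : u - v ≠ 0 := sub_ne_zero.2 huv
  have h5 : u - w ≠ 0 := sub_ne_zero.2 huw
  have h6 : v - w ≠ 0 := sub_ne_zero.2 hvw
  induction n with
  | zero =>
    simp
    rw [← neg_sub u 1, ← neg_sub v 1, ← neg_sub w 1, ← neg_sub u v, ← neg_sub u w, ← neg_sub v w]
    field_simp; ring
  | succ n ih =>
    rw [H_step w (fun m => ∑ b ∈ range (m + 1), v ^ b * ∑ a ∈ range (m - b + 1), u ^ a), ih,
      H2_closed u v hu hv huv]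
    rw [← neg_sub u 1, ← neg_sub v 1, ← neg_sub w 1, ← neg_sub u v, ← neg_sub u w, ← neg_sub v w]
    field_simp
    ring

lemma Fp_eq (n : ℕ) (X Y Z : ℂ) :
    Fp (n + 2) X Y Z = X * Y * Z * ∑ c ∈ range (n + 1), (X * Y) ^ c *
      ∑ b ∈ range (n - c + 1), (X * Z) ^ b * ∑ a ∈ range (n - c - b + 1), (Y * Z) ^ a := by
  simp only [Finset.mul_sum, Fp]
  simp only [Finset.sum_sigma']
  refine Finset.sum_bij'
    (fun t _ => ⟨(t.1 + t.2.1 - t.2.2) / 2, (t.1 + t.2.2 - t.2.1) / 2,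
      (t.2.1 + t.2.2 - t.1) / 2⟩)
    (fun s _ => (s.1 + s.2.1, s.1 + s.2.2, s.2.1 + s.2.2)) ?_ ?_ ?_ ?_ ?_
  · rintro ⟨j, k, l⟩ h
    simp only [Finset.mem_filter, Finset.mem_product, Finset.mem_range, Finset.mem_sigma,
      Nat.even_iff] at h ⊢
    omega
  · rintro ⟨c, b, a⟩ h
    simp only [Finset.mem_filter, Finset.mem_product, Finset.mem_range, Finset.mem_sigma,
      Nat.even_iff] at h ⊢
    omega
  · rintro ⟨j, k, l⟩ h
    simp only [Finset.mem_filter, Finset.mem_product, Finset.mem_range, Nat.even_iff] at h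
    simp only [Prod.mk.injEq]
    omega
  · rintro ⟨c, b, a⟩ h
    have e1 : (c + b + (c + a) - (b + a)) / 2 = c := by omega
    have e2 : (c + b + (b + a) - (c + a)) / 2 = b := by omega
    have e3 : (c + a + (b + a) - (c + b)) / 2 = a := by omega
    simp only [e1, e2, e3]
  · rintro ⟨j, k, l⟩ h
    simp only [Finset.mem_filter, Finset.mem_product, Finset.mem_range, Nat.even_iff] at h
    dsimp only
    obtain ⟨c, hc⟩ : ∃ c, c = (j + k - l) / 2 := ⟨_, rfl⟩
    obtain ⟨b, hb⟩ : ∃ b, b = (j + l - k) / 2 := ⟨_, rfl⟩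
    obtain ⟨a, ha⟩ : ∃ a, a = (k + l - j) / 2 := ⟨_, rfl⟩
    rw [← hc, ← hb, ← ha]
    have hj : j = c + b := by omega
    have hk : k = c + a := by omega
    have hl : l = b + a := by omega
    rw [hj, hk, hl]
    ring

/-- Brion-type evaluation of the generating polynomial `F_p`. -/
theorem stmt_1 (p : ℕ) (hp : Odd p) (hp3 : 3 ≤ p) (X Y Z : ℂ)
    (hX0 : X ≠ 0) (hY0 : Y ≠ 0) (hZ0 : Z ≠ 0)
    (hXY : X ≠ Y) (hXZ : X ≠ Z) (hYZ : Y ≠ Z)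
    (hXY1 : X * Y ≠ 1) (hXZ1 : X * Z ≠ 1) (hYZ1 : Y * Z ≠ 1) :
    Fp p X Y Z = X * Y * Z *
      (1 / ((1 - X * Y) * (1 - X * Z) * (1 - Y * Z))
        + X ^ p * Y ^ p / ((X * Y - 1) * (X - Z) * (Y - Z))
        + Y ^ p * Z ^ p / ((Y * Z - 1) * (Y - X) * (Z - X))
        + X ^ p * Z ^ p / ((X * Z - 1) * (X - Y) * (Z - Y))) := by
  obtain ⟨n, rfl⟩ : ∃ n, p = n + 2 := ⟨p - 2, by omega⟩
  have d1 : X - Y ≠ 0 := sub_ne_zero.2 hXY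
  have d2 : X - Z ≠ 0 := sub_ne_zero.2 hXZ
  have d3 : Y - Z ≠ 0 := sub_ne_zero.2 hYZ
  have e1 : X * Y - 1 ≠ 0 := sub_ne_zero.2 hXY1
  have e2 : X * Z - 1 ≠ 0 := sub_ne_zero.2 hXZ1
  have e3 : Y * Z - 1 ≠ 0 := sub_ne_zero.2 hYZ1
  rw [Fp_eq, H3_closed (Y * Z) (X * Z) (X * Y) hYZ1 hXZ1 hXY1
    (fun h => hXY (mul_right_cancel₀ hZ0 h).symm)
    (fun h => hXZ (mul_left_cancel₀ hY0 (h.trans (mul_comm _ _))).symm)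
    (fun h => hYZ (mul_left_cancel₀ hX0 h).symm) n]
  have f1 : Y * Z - X * Z = -(Z * (X - Y)) := by ring
  have f2 : Y * Z - X * Y = -(Y * (X - Z)) := by ring
  have f3 : X * Z - X * Y = -(X * (Y - Z)) := by ring
  have g1 : X * Z - Y * Z = Z * (X - Y) := by ring
  have g2 : X * Y - Y * Z = Y * (X - Z) := by ring
  have g3 : X * Y - X * Z = X * (Y - Z) := by ring
  rw [f1, f2, f3, g1, g2, g3, ← neg_sub (X * Y) 1, ← neg_sub (X * Z) 1, ← neg_sub (Y * Z) 1,
    ← neg_sub X Y, ← neg_sub X Z, ← neg_sub Y Z]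
  field_simp
  ring
end

section
/- Let p ≥ 3 be an odd integer and let X, Z be complex numbers satisfying X^p = Z^p = -1, X² ≠ 1, X ≠ Z, and XZ ≠ 1. Then F_p(X,X,Z) = pXZ / ((1-XZ)(X-Z)). -/
open Finset


open Finset

lemma aux_sum_m (u : ℂ) (n : ℕ) :
    (∑ m ∈ range n, (m : ℂ) * u ^ m) * (u - 1) = n * u ^ n - ∑ m ∈ range n, u ^ (m + 1) := by
  induction n with
  | zero => simp
  | succ n ih =>
    rw [sum_range_succ, sum_range_succ, add_mul, ih]
    push_cast
    ring

lemma aux_root (u : ℂ) (n : ℕ) (hu : u ^ n = 1) (h1 : u ≠ 1) :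
    ∑ m ∈ range n, (m : ℂ) * u ^ m = n / (u - 1) := by
  have h : u - 1 ≠ 0 := sub_ne_zero.mpr h1
  rw [eq_div_iff h, aux_sum_m, hu]
  have : ∑ m ∈ range n, u ^ (m + 1) = 0 := by
    simp only [pow_succ]
    rw [← sum_mul, geom_sum_eq h1, hu]
    simp
  rw [this]; ring

lemma aux_reindex (p : ℕ) (X Z : ℂ) :
    Fp p X X Z = ∑ l ∈ range (p - 1), ∑ q ∈ range (l + 1) ×ˢ range (p - 1 - l),
      X ^ (l + 2 + 2 * q.2) * Z ^ (l + 1) := by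
  unfold Fp
  rw [sum_sigma']
  refine sum_bij' (fun t _ => ⟨t.2.2, ((t.1 + t.2.2 - t.2.1) / 2, (t.1 + t.2.1 - t.2.2) / 2)⟩)
    (fun x _ => (x.2.1 + x.2.2, x.1 - x.2.1 + x.2.2, x.1)) ?_ ?_ ?_ ?_ ?_
  · rintro ⟨j, k, l⟩ h
    simp only [mem_filter, mem_product, mem_range, mem_sigma, Nat.even_iff] at h ⊢
    omega
  · rintro ⟨l, a, i⟩ h
    simp only [mem_filter, mem_product, mem_range, mem_sigma, Nat.even_iff] at h ⊢
    omega
  · rintro ⟨j, k, l⟩ h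
    simp only [mem_filter, mem_product, mem_range, Nat.even_iff] at h
    have h1 : (j + l - k) / 2 + (j + k - l) / 2 = j := by omega
    have h2 : l - (j + l - k) / 2 + (j + k - l) / 2 = k := by omega
    simp only [h1, h2]
  · rintro ⟨l, a, i⟩ h
    simp only [mem_product, mem_range, mem_sigma] at h
    have h1 : (a + i + l - (l - a + i)) / 2 = a := by omega
    have h2 : (a + i + (l - a + i) - l) / 2 = i := by omega
    simp only [h1, h2]
  · rintro ⟨j, k, l⟩ h
    simp only [mem_filter, mem_product, mem_range, Nat.even_iff] at h
    simp only
    rw [← pow_add]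
    congr 2
    omega

/-- If `X^p = Z^p = -1`, `X² ≠ 1`, `X ≠ Z` and `XZ ≠ 1`, then
`F_p(X,X,Z) = pXZ/((1-XZ)(X-Z))`. -/
theorem stmt_3 (p : ℕ) (hp : Odd p) (hp3 : 3 ≤ p) (X Z : ℂ)
    (hXp : X ^ p = -1) (hZp : Z ^ p = -1)
    (hX2 : X ^ 2 ≠ 1) (hXZ : X ≠ Z) (hXZ1 : X * Z ≠ 1) :
    Fp p X X Z = (p : ℂ) * X * Z / ((1 - X * Z) * (X - Z)) := by
  have hX0 : X ≠ 0 := by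
    rintro rfl
    rw [zero_pow (by omega)] at hXp
    norm_num at hXp
  have hX2' : X ^ 2 - 1 ≠ 0 := sub_ne_zero.mpr hX2
  have hu : (Z / X) ^ p = 1 := by rw [div_pow, hXp, hZp]; norm_num
  have hu1 : Z / X ≠ 1 := by
    rw [Ne, div_eq_one_iff_eq hX0]
    exact fun h => hXZ h.symm
  have hv : (X * Z) ^ p = 1 := by rw [mul_pow, hXp, hZp]; norm_num
  have key : Fp p X X Z = X / (X ^ 2 - 1) *
      (∑ m ∈ range p, (m : ℂ) * (Z / X) ^ m - ∑ m ∈ range p, (m : ℂ) * (X * Z) ^ m) := by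
    rw [aux_reindex, ← sum_sub_distrib]
    obtain ⟨n, rfl⟩ : ∃ n, p = n + 1 := ⟨p - 1, by omega⟩
    rw [sum_range_succ' _ n, mul_add, mul_sum]
    simp only [Nat.add_sub_cancel, Nat.cast_zero, zero_mul, sub_zero, mul_zero, add_zero]
    refine sum_congr rfl fun l hl => ?_
    rw [mem_range] at hl
    rw [sum_product]
    simp only [sum_const, card_range, nsmul_eq_mul]
    have e : ∑ i ∈ range (n - l), X ^ (l + 2 + 2 * i) * Z ^ (l + 1)
        = X ^ (l + 2) * Z ^ (l + 1) * (((X ^ 2) ^ (n - l) - 1) / (X ^ 2 - 1)) := by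
      rw [← geom_sum_eq hX2, mul_sum]
      refine sum_congr rfl fun i _ => ?_
      rw [pow_add, pow_mul]; ring
    rw [e]
    have e2 : (X ^ 2) ^ (n - l) * (X ^ 2) ^ (l + 1) = 1 := by
      rw [← pow_add, show n - l + (l + 1) = n + 1 by omega, ← pow_mul, mul_comm, pow_mul, hXp]
      norm_num
    have e3 : (X ^ 2) ^ (n - l) = 1 / (X ^ (l + 1) * X ^ (l + 1)) := by
      rw [eq_div_iff (by positivity), ← e2]; ring
    rw [e3, div_pow, mul_pow, pow_succ X (l + 1)]
    have hY : X ^ (l + 1) ≠ 0 := pow_ne_zero _ hX0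
    generalize X ^ (l + 1) = Y at *
    generalize Z ^ (l + 1) = W at *
    field_simp
  rw [key, aux_root _ _ hu hu1, aux_root _ _ hv hXZ1]
  have h1 : X * Z - 1 ≠ 0 := sub_ne_zero.mpr hXZ1
  have h2 : X - Z ≠ 0 := sub_ne_zero.mpr hXZ
  have h3 : 1 - X * Z ≠ 0 := sub_ne_zero.mpr (Ne.symm hXZ1)
  have h4 : Z - X ≠ 0 := sub_ne_zero.mpr (Ne.symm hXZ)
  have h5 : Z / X - 1 = (Z - X) / X := by field_simp
  rw [h5, div_div_eq_mul_div, div_sub_div _ _ h4 h1, div_mul_div_comm, div_eq_div_iff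
    (mul_ne_zero hX2' (mul_ne_zero h4 h1)) (mul_ne_zero h3 h2)]
  ring
end

section
/- Let p ≥ 3 be an odd integer and let Z be a complex number satisfying Z^p = -1 and Z ≠ -1. Then F_p(-1,-1,Z) = 2pZ / (1+Z)². -/
open Finset


open Finset

theorem Fp_aux (p : ℕ) (Z : ℂ) : Fp p (-1) (-1) Z =
    ∑ l ∈ range (p - 1), ((l : ℂ) + 1) * ((p - 1 - l : ℕ) : ℂ) * (-(-Z) ^ (l + 1)) := by
  have h1 : Fp p (-1) (-1) Z =
      ∑ x ∈ (range (p - 1)).sigma (fun l => range (l + 1) ×ˢ range (p - 1 - l)),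
        (-(-Z) ^ (x.1 + 1)) := by
    unfold Fp
    refine Finset.sum_bij' (fun t _ => ⟨t.2.2, ((t.1 + t.2.2 - t.2.1) / 2, (t.1 + t.2.1 - t.2.2) / 2)⟩)
      (fun x _ => (x.2.1 + x.2.2, x.1 - x.2.1 + x.2.2, x.1)) ?_ ?_ ?_ ?_ ?_
    · rintro ⟨j, k, l⟩ h
      simp only [mem_filter, mem_product, mem_range, mem_sigma, Nat.even_iff] at h ⊢
      omega
    · rintro ⟨l, a, b⟩ h
      simp only [mem_filter, mem_product, mem_range, mem_sigma, Nat.even_iff] at h ⊢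
      omega
    · rintro ⟨j, k, l⟩ h
      simp only [mem_filter, mem_product, mem_range, Nat.even_iff] at h
      simp only [Prod.mk.injEq, and_true]
      omega
    · rintro ⟨l, a, b⟩ h
      simp only [mem_product, mem_range, mem_sigma] at h
      simp only [Sigma.mk.injEq, heq_eq_eq, Prod.mk.injEq, true_and]
      omega
    · rintro ⟨j, k, l⟩ h
      simp only [mem_filter, mem_product, mem_range] at h
      have he := h.2.1
      simp only
      rw [neg_pow Z (l + 1)]
      have h2 : (-1 : ℂ) ^ (j + k + l) = 1 := he.neg_one_pow
      have h3 : (-1 : ℂ) ^ l * (-1) ^ l = 1 := by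
        rw [← mul_pow]; simp
      have h4 : (-1 : ℂ) ^ j * (-1) ^ k = (-1) ^ l := by
        rw [pow_add, pow_add] at h2
        linear_combination (-1) ^ l * h2 - (-1) ^ j * (-1) ^ k * h3
      rw [pow_succ (-1 : ℂ), pow_succ (-1 : ℂ), pow_succ (-1 : ℂ)]
      linear_combination Z ^ (l + 1) * h4
  rw [h1, Finset.sum_sigma]
  refine Finset.sum_congr rfl fun l _ => ?_
  simp [Finset.sum_const, card_product]

theorem tele_aux (c W : ℂ) (hW : W - 1 ≠ 0) (n : ℕ) :
    ∑ l ∈ range n, ((l : ℂ) + 1) * (c - 1 - l) * W ^ (l + 1) * (W - 1) ^ 3 =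
      (-((n : ℂ) + 1) ^ 2 * (W - 1) ^ 2 + (n + 1) * (c * (W - 1) ^ 2 + 2 * W * (W - 1))
        - (W * (c * (W - 1) + 2 * W - (W - 1)))) * W ^ (n + 1)
       + W * (W * (c * (W - 1) + 2 * W - (W - 1)) - (-(W - 1) ^ 2 + (c * (W - 1) ^ 2 + 2 * W * (W - 1)))) := by
  induction n with
  | zero => simp; ring
  | succ n ih =>
    rw [Finset.sum_range_succ, ih]
    push_cast
    ring

/-- If `Z^p = -1` and `Z ≠ -1`, then `F_p(-1,-1,Z) = 2pZ/(1+Z)²`. -/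
theorem stmt_4 (p : ℕ) (hp : Odd p) (hp3 : 3 ≤ p) (Z : ℂ)
    (hZp : Z ^ p = -1) (hZ : Z ≠ -1) :
    Fp p (-1) (-1) Z = 2 * (p : ℂ) * Z / (1 + Z) ^ 2 := by
  rw [Fp_aux]
  have hW : (-Z) - 1 ≠ 0 := fun h => hZ (by linear_combination -h)
  have hW' : 1 + Z ≠ 0 := fun h => hZ (by linear_combination h)
  have hp1 : (-Z) ^ (p - 1 + 1) = 1 := by
    rw [Nat.sub_add_cancel (by omega), hp.neg_pow, hZp, neg_neg]
  have ht := tele_aux p (-Z) hW (p - 1)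
  rw [hp1, Nat.cast_sub (by omega), ← Finset.sum_mul] at ht
  have hs : ∑ l ∈ range (p - 1), ((l : ℂ) + 1) * ((p - 1 - l : ℕ) : ℂ) * (-(-Z) ^ (l + 1)) =
      -∑ l ∈ range (p - 1), ((l : ℂ) + 1) * ((p : ℂ) - 1 - l) * (-Z) ^ (l + 1) := by
    rw [← Finset.sum_neg_distrib]
    refine Finset.sum_congr rfl fun l hl => ?_
    rw [mem_range] at hl
    rw [Nat.cast_sub (by omega), Nat.cast_sub (by omega)]
    push_cast
    ring
  rw [hs, eq_div_iff (pow_ne_zero 2 hW')]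
  apply mul_right_cancel₀ hW'
  push_cast at ht
  linear_combination ht
end

section
/- Let 0 < q < p be coprime odd integers. Then Σ_{(j,k,ℓ) ∈ Δ_p} (-1)^{⌊jq/p⌋ + ⌊kq/p⌋ + ⌊ℓq/p⌋} = (1-p²)/(6p²) + (1/(4p²)) · Σ_{n=1, n odd}^{p-2} f(n,p,q) / ( sin³(nπ/(2p)) · sin²(qnπ/p) ). -/
open Real Finset

/-- The trigonometric expression `f(n,p,q)` from Theorem 3.1. -/
noncomputable def fnpq (n p q : ℕ) : ℝ :=
  (3 * (p : ℝ) - 3) * Real.sin ((2 * (q : ℝ) - 1) * n * π / (2 * p))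
    + ((p : ℝ) + 1) * Real.sin ((2 * (q : ℝ) - 3) * n * π / (2 * p))
    + ((p : ℝ) - 1) * Real.sin ((2 * (q : ℝ) + 3) * n * π / (2 * p))
    + (3 * (p : ℝ) + 3) * Real.sin ((2 * (q : ℝ) + 1) * n * π / (2 * p))

lemma perm_sum (N : ℕ) (hN : 0 < N) (F : ℤ → ℝ) (hF : ∀ a, F (a + N) = F a) (u c : ℤ)
    (hu : IsCoprime u (N : ℤ)) :
    ∑ k ∈ range N, F (u * k + c) = ∑ k ∈ range N, F k := by
  have hper : ∀ a : ℤ, ∀ n : ℕ, F (a + n * N) = F a := by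
    intro a n
    induction n with
    | zero => simp
    | succ n ih => rw [← ih, ← hF (a + n * N)]; congr 1; push_cast; ring
  have hper' : ∀ a : ℤ, ∀ n : ℤ, F (a + n * N) = F a := by
    intro a n
    rcases Int.le_total 0 n with h | h
    · lift n to ℕ using h
      exact hper a n
    · obtain ⟨m, rfl⟩ : ∃ m : ℕ, n = -m := ⟨n.natAbs, by omega⟩
      rw [← hper (a + -(m : ℤ) * N) m]; congr 1; ring
  have hmod : ∀ a : ℤ, F (a % N) = F a := by
    intro a
    rw [← hper' (a % N) (a / N)]
    congr 1
    rw [mul_comm]; exact Int.emod_add_mul_ediv a N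
  have hNz : (N : ℤ) ≠ 0 := by exact_mod_cast hN.ne'
  have hmaps : Set.MapsTo (fun k : ℕ => ((u * k + c) % N).toNat) (range N) (range N) := by
    intro k _
    have h1 := Int.emod_nonneg (u * k + c) hNz
    have h2 := Int.emod_lt_of_pos (u * k + c) (by exact_mod_cast hN : (0 : ℤ) < N)
    simp only [coe_range, Set.mem_Iio]
    omega
  have hinj : Set.InjOn (fun k : ℕ => ((u * k + c) % N).toNat) (range N) := by
    intro a ha b hb hab
    simp only [coe_range, Set.mem_Iio] at ha hb hab
    have h1 := Int.emod_nonneg (u * a + c) hNz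
    have h2 := Int.emod_nonneg (u * b + c) hNz
    have h3 : (u * a + c) % N = (u * b + c) % N := by omega
    have h4 : (N : ℤ) ∣ u * (a - b) := by
      have := Int.emod_emod_of_dvd
      have h5 := Int.ModEq.dvd (show (u * b + c) ≡ (u * a + c) [ZMOD N] from h3.symm)
      convert h5 using 1; ring
    have h6 : (N : ℤ) ∣ a - b := hu.symm.dvd_of_dvd_mul_left h4
    have h7 : (a : ℤ) - b = 0 := by
      apply Int.eq_zero_of_abs_lt_dvd h6
      rw [abs_lt]; constructor <;> omega
    omega
  refine Finset.sum_nbij (fun k : ℕ => ((u * k + c) % N).toNat) hmaps hinj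
    (Finset.surjOn_of_injOn_of_card_le _ hmaps hinj le_rfl) ?_
  intro k _
  have h1 := Int.emod_nonneg (u * k + c) hNz
  simp only [Int.toNat_of_nonneg h1]
  rw [hmod]

lemma sum_cos_closed (y : ℝ) (n : ℕ) :
    2 * sin (y / 2) * ∑ m ∈ range n, cos (m * y) = sin (n * y - y / 2) + sin (y / 2) := by
  induction n with
  | zero => simp [Real.sin_neg]
  | succ n ih =>
    rw [sum_range_succ, mul_add, ih]
    have h1 : ((n + 1 : ℕ) : ℝ) * y - y / 2 = n * y + y / 2 := by push_cast; ring
    rw [h1, Real.sin_add, Real.sin_sub]; ring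

lemma sum_sin_closed (y : ℝ) (n : ℕ) :
    2 * sin (y / 2) * ∑ m ∈ range n, sin (m * y) = cos (y / 2) - cos (n * y - y / 2) := by
  induction n with
  | zero => simp [Real.cos_neg]
  | succ n ih =>
    rw [sum_range_succ, mul_add, ih]
    have h1 : ((n + 1 : ℕ) : ℝ) * y - y / 2 = n * y + y / 2 := by push_cast; ring
    rw [h1, Real.cos_add, Real.cos_sub]; ring

lemma sin_zero_iff (N : ℕ) (hN : 0 < N) (a : ℤ) : sin (π * a / N) = 0 ↔ (N : ℤ) ∣ a := by
  have hN' : (N : ℝ) ≠ 0 := by exact_mod_cast hN.ne'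
  rw [Real.sin_eq_zero_iff]
  constructor
  · rintro ⟨n, hn⟩
    refine ⟨n, ?_⟩
    have : (n : ℝ) * N = a := by
      field_simp at hn
      have := pi_pos.ne'
      linarith
    have : n * N = a := by exact_mod_cast this
    rw [← this]; ring
  · rintro ⟨n, rfl⟩
    refine ⟨n, ?_⟩
    push_cast; field_simp

lemma ortho (N : ℕ) (hN : 0 < N) (a : ℤ) :
    ∑ m ∈ range N, cos (m * (2 * π * a / N)) = if (N : ℤ) ∣ a then (N : ℝ) else 0 := by
  have hN' : (N : ℝ) ≠ 0 := by exact_mod_cast hN.ne'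
  split_ifs with h
  · obtain ⟨b, rfl⟩ := h
    rw [Finset.sum_congr rfl (g := fun _ => (1 : ℝ))]
    · simp
    · intro m _
      have : (m : ℝ) * (2 * π * ((N * b : ℤ) : ℝ) / N) = ((m * b : ℤ) : ℝ) * (2 * π) := by
        push_cast; field_simp
      rw [this, Real.cos_int_mul_two_pi]
  · have h1 := sum_cos_closed (2 * π * a / N) N
    have h2 : (N : ℝ) * (2 * π * a / N) - 2 * π * a / N / 2
        = -(2 * π * a / N / 2) + a * (2 * π) := by field_simp; ring
    rw [h2, Real.sin_add_int_mul_two_pi, Real.sin_neg, neg_add_cancel] at h1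
    have h3 : 2 * π * a / N / 2 = π * a / N := by ring
    rw [h3] at h1
    have h4 : sin (π * a / N) ≠ 0 := fun h' => h ((sin_zero_iff N hN a).1 h')
    rcases mul_eq_zero.1 h1 with h5 | h5
    · exact absurd h5 (mul_ne_zero two_ne_zero h4)
    · exact h5

lemma csc_tele (p y : ℝ) (n : ℕ) :
    2 * (1 - cos y) * ∑ j ∈ range n, (j * (p - j)) * cos (j * y)
      = cos (n * y - y) * (n * (p - n)) - ((n - 1) * (p - n + 1)) * cos (n * y) - (p + 1)
        + 2 * ∑ j ∈ range n, cos (j * y) := by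
  induction n with
  | zero => simp
  | succ n ih =>
    rw [sum_range_succ, sum_range_succ, mul_add, mul_add, ih]
    have h1 : ((n + 1 : ℕ) : ℝ) * y - y = n * y := by push_cast; ring
    have h2 : ((n + 1 : ℕ) : ℝ) * y = n * y + y := by push_cast; ring
    rw [h1, h2, Real.cos_add, Real.cos_sub]; push_cast; ring

lemma sum_quad (p : ℝ) (n : ℕ) :
    ∑ j ∈ range n, ((j : ℝ) * (p - j)) = p * (n * (n - 1) / 2) - (n - 1) * n * (2 * n - 1) / 6 := by
  induction n with
  | zero => simp
  | succ n ih => rw [sum_range_succ, ih]; push_cast; ring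

lemma csc_formula (p : ℕ) (hp : 0 < p) (i : ℕ) (hi : 0 < i) (hip : i < p) :
    1 / sin (π * i / p) ^ 2
      = -(2 / p) * ∑ j ∈ range p, ((j : ℝ) * (p - j)) * cos (j * (2 * π * (i : ℤ) / p)) := by
  have hp' : (p : ℝ) ≠ 0 := by exact_mod_cast hp.ne'
  have hnd : ¬ (p : ℤ) ∣ (i : ℤ) := by
    intro h
    have := Nat.le_of_dvd hi (by exact_mod_cast h)
    omega
  have h1 := csc_tele p (2 * π * (i : ℤ) / p) p
  rw [ortho p hp, if_neg hnd] at h1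
  have h2 : (p : ℝ) * (2 * π * (i : ℤ) / p) = (i : ℤ) * (2 * π) := by field_simp
  rw [h2, Real.cos_int_mul_two_pi] at h1
  have h3 : cos (2 * π * (i : ℤ) / p) = 1 - 2 * sin (π * i / p) ^ 2 := by
    have : 2 * π * (i : ℤ) / p = 2 * (π * i / p) := by push_cast; ring
    rw [this, Real.cos_two_mul]
    have := Real.sin_sq_add_cos_sq (π * i / p)
    linarith
  have h4 : sin (π * i / p) ≠ 0 := by
    have := (sin_zero_iff p hp i).not.2 hnd
    simpa using this
  rw [h3] at h1
  set S := ∑ j ∈ range p, ((j : ℝ) * (p - j)) * cos (j * (2 * π * (i : ℤ) / p))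
  field_simp
  linarith

lemma csc_sum (p : ℕ) (hp : 0 < p) :
    ∑ i ∈ range p, 1 / sin (π * i / p) ^ 2 = ((p : ℝ) ^ 2 - 1) / 3 := by
  have hp' : (p : ℝ) ≠ 0 := by exact_mod_cast hp.ne'
  set A : ℕ → ℝ := fun i =>
    -(2 / p) * ∑ j ∈ range p, ((j : ℝ) * (p - j)) * cos (j * (2 * π * (i : ℤ) / p)) with hA
  have hA0 : A 0 = -(((p : ℝ) ^ 2 - 1) / 3) := by
    simp only [hA]
    simp only [Nat.cast_zero, Int.cast_zero, mul_zero, zero_div, Real.cos_zero, mul_one]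
    rw [sum_quad]; field_simp; ring
  have hAs : ∑ i ∈ range p, A i = 0 := by
    simp only [hA]
    rw [← mul_sum, sum_comm]
    rw [Finset.sum_eq_zero, mul_zero]
    intro j hj
    rw [← mul_sum]
    rcases Nat.eq_zero_or_pos j with rfl | hj0
    · simp
    · have h1 := ortho p hp j
      have hnd : ¬ (p : ℤ) ∣ (j : ℤ) := by
        intro h
        have := Nat.le_of_dvd hj0 (by exact_mod_cast h)
        have := mem_range.1 hj
        omega
      rw [if_neg hnd] at h1
      have h2 : ∑ i ∈ range p, cos (j * (2 * π * (i : ℤ) / p)) = 0 := by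
        rw [← h1]
        apply sum_congr rfl
        intro i _
        congr 1; push_cast; ring
      rw [h2, mul_zero]
  obtain ⟨n, rfl⟩ : ∃ n, p = n + 1 := ⟨p - 1, by omega⟩
  rw [sum_range_succ'] at hAs ⊢
  have h3 : ∑ i ∈ range n, 1 / sin (π * ((i + 1 : ℕ) : ℝ) / ((n + 1 : ℕ) : ℝ)) ^ 2
      = ∑ i ∈ range n, A (i + 1) := by
    apply sum_congr rfl
    intro i hi
    have := mem_range.1 hi
    exact csc_formula (n + 1) hp (i + 1) (by omega) (by omega)
  rw [h3]
  simp only [Nat.cast_zero, mul_zero, zero_div, Real.sin_zero]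
  norm_num
  push_cast at hA0 ⊢
  linarith

noncomputable def sn (p : ℕ) (a : ℤ) : ℝ := sin (π * a / p)

lemma sn_per (p : ℕ) (hp : 0 < p) (a b : ℤ) : sn p (a + 2 * p * b) = sn p a := by
  have hp' : (p : ℝ) ≠ 0 := by exact_mod_cast hp.ne'
  unfold sn
  have : π * ((a + 2 * p * b : ℤ) : ℝ) / p = π * a / p + b * (2 * π) := by
    push_cast; field_simp
  rw [this, Real.sin_add_int_mul_two_pi]

lemma sn_neg (p : ℕ) (a : ℤ) : sn p (-a) = - sn p a := by
  unfold sn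
  rw [← Real.sin_neg]; congr 1; push_cast; ring

lemma sn_zero_iff (p : ℕ) (hp : 0 < p) (a : ℤ) : sn p a = 0 ↔ (p : ℤ) ∣ a :=
  sin_zero_iff p hp a

lemma sn_pos (p : ℕ) (a : ℤ) (h0 : 0 < a) (h1 : a < p) : 0 < sn p a := by
  have hp : 0 < (p : ℝ) := by
    have : (0 : ℤ) < p := by omega
    exact_mod_cast this
  have h0' : (0 : ℝ) < a := by exact_mod_cast h0
  have h1' : (a : ℝ) < p := by exact_mod_cast h1
  unfold sn
  apply Real.sin_pos_of_pos_of_lt_pi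
  · positivity
  · rw [div_lt_iff₀ hp]
    exact mul_lt_mul_of_pos_left h1' pi_pos

lemma ortho2 (p : ℕ) (hp : 0 < p) (r l : ℤ) :
    ∑ m ∈ range (2 * p), sn p (m * r) * sn p (m * l)
      = p * ((if (2 * p : ℤ) ∣ r - l then 1 else 0) - (if (2 * p : ℤ) ∣ r + l then 1 else 0)) := by
  have hp' : (p : ℝ) ≠ 0 := by exact_mod_cast hp.ne'
  have h1 := ortho (2 * p) (by omega) (r - l)
  have h2 := ortho (2 * p) (by omega) (r + l)
  have h3 : ∑ m ∈ range (2 * p), sn p (m * r) * sn p (m * l)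
      = (∑ m ∈ range (2 * p), cos (m * (2 * π * ((r - l : ℤ) : ℝ) / (2 * p : ℕ)))
        - ∑ m ∈ range (2 * p), cos (m * (2 * π * ((r + l : ℤ) : ℝ) / (2 * p : ℕ)))) / 2 := by
    rw [← sum_sub_distrib, sum_div]
    apply sum_congr rfl
    intro m _
    unfold sn
    have e1 : (m : ℝ) * (2 * π * ((r - l : ℤ) : ℝ) / (2 * p : ℕ))
      = π * ((m * r : ℤ) : ℝ) / p - π * ((m * l : ℤ) : ℝ) / p := by
      push_cast; field_simp
    have e2 : (m : ℝ) * (2 * π * ((r + l : ℤ) : ℝ) / (2 * p : ℕ))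
      = π * ((m * r : ℤ) : ℝ) / p + π * ((m * l : ℤ) : ℝ) / p := by
      push_cast; field_simp
    rw [e1, e2, Real.cos_add, Real.cos_sub]; ring
  rw [h3, h1, h2]
  push_cast
  split_ifs <;> ring

lemma prod_sin (b x : ℝ) (j : ℕ) :
    sin x * ∑ i ∈ range j, sin (b + 2 * i * x) = sin (j * x) * sin (b + (j - 1) * x) := by
  induction j with
  | zero => simp
  | succ j ih =>
    rw [sum_range_succ, mul_add, ih]
    have e1 : b + 2 * j * x = (b + j * x) + j * x := by ring
    have e2 : b + ((j : ℝ) - 1) * x = (b + j * x) - x := by ring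
    have e3 : b + (((j + 1 : ℕ) : ℝ) - 1) * x = b + j * x := by push_cast; ring
    have e4 : ((j + 1 : ℕ) : ℝ) * x = j * x + x := by push_cast; ring
    rw [e1, e2, e3, e4]
    generalize b + (j : ℝ) * x = c
    rw [Real.sin_add c, Real.sin_sub, Real.sin_add]; ring

lemma prod_sn (p j : ℕ) (m k : ℤ) :
    sn p (m * j) * sn p (m * k) = sn p m * ∑ i ∈ range j, sn p (m * (k - j + 1 + 2 * i)) := by
  have h := prod_sin (π * ((m * (k - j + 1) : ℤ) : ℝ) / p) (π * m / p) j
  have e : ∀ i : ℕ, sn p (m * (k - j + 1 + 2 * i))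
      = sin (π * ((m * (k - j + 1) : ℤ) : ℝ) / p + 2 * i * (π * m / p)) := by
    intro i; unfold sn; congr 1; push_cast; ring
  rw [sum_congr rfl (fun i _ => e i)]
  unfold sn
  rw [h]
  congr 2 <;> (push_cast; ring)

lemma count_one (j : ℕ) (k t : ℤ) :
    ∑ i ∈ range j, (if k - j + 1 + 2 * (i : ℤ) = t then (1 : ℝ) else 0)
      = if (Odd (j + k + t) ∧ k - j < t ∧ t < k + j) then 1 else 0 := by
  split_ifs with h
  · obtain ⟨⟨w, hw⟩, h1, h2⟩ := h
    rw [sum_eq_single ((t - k + j - 1) / 2).toNat]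
    · rw [if_pos]; omega
    · intro b _ hb
      rw [if_neg]; omega
    · intro hb
      rw [mem_range] at hb
      exfalso; omega
  · apply sum_eq_zero
    intro i hi
    rw [mem_range] at hi
    rw [if_neg]
    intro h'
    apply h
    refine ⟨⟨k + i, by omega⟩, by omega, by omega⟩

lemma verlinde (p j k l : ℕ) (hj : 0 < j) (hk : 0 < k) (hl : 0 < l)
    (hj' : j < p) (hk' : k < p) (hl' : l < p) :
    ∑ m ∈ range (2 * p), sn p (m * j) * sn p (m * k) * sn p (m * l) / sn p m
      = if (j < k + l ∧ k < j + l ∧ l < j + k ∧ j + k + l < 2 * p ∧ Odd (j + k + l))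
        then (p : ℝ) else 0 := by
  have hp : 0 < p := by omega
  have h1 : ∀ m : ℕ, sn p (m * j) * sn p (m * k) * sn p (m * l) / sn p m
      = ∑ i ∈ range j, sn p (m * (k - j + 1 + 2 * i)) * sn p (m * l) := by
    intro m
    rw [prod_sn, ← sum_mul]
    by_cases h : sn p m = 0
    · have : sn p (m * l) = 0 := by
        rw [sn_zero_iff p hp] at h ⊢
        exact Dvd.dvd.mul_right h _
      simp [this]
    · field_simp
  rw [sum_congr rfl (fun m _ => h1 m), sum_comm]
  rw [sum_congr rfl (fun (i : ℕ) _ => ortho2 p hp (k - j + 1 + 2 * (i : ℤ)) l)]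
  have h2 : ∀ i ∈ range j, (p : ℝ) * ((if (2 * p : ℤ) ∣ (k - j + 1 + 2 * i) - l then 1 else 0)
      - (if (2 * p : ℤ) ∣ (k - j + 1 + 2 * i) + l then 1 else 0))
      = p * ((if (k : ℤ) - j + 1 + 2 * i = l then 1 else 0)
        - (if (k : ℤ) - j + 1 + 2 * i = -l then 1 else 0)
        - (if (k : ℤ) - j + 1 + 2 * i = 2 * p - l then 1 else 0)) := by
    intro i hi
    rw [mem_range] at hi
    have a1 : ((2 * p : ℤ) ∣ (k - j + 1 + 2 * i) - l) ↔ (k : ℤ) - j + 1 + 2 * i = l := by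
      constructor
      · intro h
        have := Int.eq_zero_of_abs_lt_dvd h (by rw [abs_lt]; constructor <;> omega)
        omega
      · intro h; rw [h]; simp
    have a2 : ((2 * p : ℤ) ∣ (k - j + 1 + 2 * i) + l) ↔
        ((k : ℤ) - j + 1 + 2 * i = -l ∨ (k : ℤ) - j + 1 + 2 * i = 2 * p - l) := by
      constructor
      · intro h
        by_cases hc : (k : ℤ) - j + 1 + 2 * i + l < 2 * p
        · have := Int.eq_zero_of_abs_lt_dvd h (by rw [abs_lt]; constructor <;> omega)
          omega
        · have h' : (2 * p : ℤ) ∣ (k - j + 1 + 2 * i) + l - 2 * p := dvd_sub_self_right.2 h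
          have := Int.eq_zero_of_abs_lt_dvd h' (by rw [abs_lt]; constructor <;> omega)
          omega
      · rintro (h | h)
        · rw [h]; simp
        · rw [h]; simp
    simp only [a1, a2]
    by_cases b1 : (k : ℤ) - j + 1 + 2 * i = -l
    · have b2 : ¬ ((k : ℤ) - j + 1 + 2 * i = 2 * p - l) := by omega
      simp only [b1, true_or, if_true]
      have b3 : ¬ (-(l : ℤ) = 2 * p - l) := by omega
      simp only [b3, if_false]
      ring
    · simp only [b1, false_or, if_false]; ring
  rw [sum_congr rfl h2, ← mul_sum, sum_sub_distrib, sum_sub_distrib, count_one, count_one,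
    count_one]
  by_cases ho : Odd (j + k + l)
  · have o1 : Odd ((j : ℤ) + k + l) := by exact_mod_cast ho
    have o2 : Odd ((j : ℤ) + k + -l) := by
      obtain ⟨w, hw⟩ := o1; exact ⟨w - l, by omega⟩
    have o3 : Odd ((j : ℤ) + k + (2 * p - l)) := by
      obtain ⟨w, hw⟩ := o1; exact ⟨w - l + p, by omega⟩
    simp only [o1, o2, o3, ho, true_and, and_true]
    obtain ⟨w, hw⟩ := ho
    split_ifs <;> first | omega | ring
  · have o1 : ¬ Odd ((j : ℤ) + k + l) := by exact_mod_cast ho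
    have o2 : ¬ Odd ((j : ℤ) + k + -l) := by
      rintro ⟨w, hw⟩; exact o1 ⟨w + l, by omega⟩
    have o3 : ¬ Odd ((j : ℤ) + k + (2 * p - l)) := by
      rintro ⟨w, hw⟩; exact o1 ⟨w + l - p, by omega⟩
    simp only [o1, o2, o3, ho, false_and, and_false, if_false]
    ring

lemma reflect_sum (p : ℕ) (hp : 0 < p) (F : ℤ → ℝ) (h0 : F 0 = 0) (hFp : F p = 0)
    (hF : ∀ a : ℤ, F (2 * p - a) = F a) :
    ∑ i ∈ range (2 * p), F i = 2 * ∑ i ∈ range p, F i := by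
  obtain ⟨n, rfl⟩ : ∃ n, p = n + 1 := ⟨p - 1, by omega⟩
  rw [two_mul (n + 1), sum_range_add, two_mul]
  congr 1
  rw [sum_range_succ', sum_range_succ' (fun i : ℕ => F i)]
  have e1 : F ((n + 1 + 0 : ℕ) : ℤ) = F ((0 : ℕ) : ℤ) := by
    rw [add_zero, hFp]; simp [h0]
  rw [e1]
  congr 1
  rw [← sum_range_reflect]
  apply sum_congr rfl
  intro i hi
  rw [mem_range] at hi
  rw [← hF]
  congr 1
  omega


lemma sign_floor (p q j : ℕ) (hp : 0 < p) (hco : Nat.Coprime q p) (hj : 0 < j) (hjp : j < p) :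
    (-1 : ℝ) ^ ⌊((j * q : ℕ) : ℝ) / p⌋ = Real.sign (sn p (q * j)) := by
  have hp' : (p : ℝ) ≠ 0 := by exact_mod_cast hp.ne'
  set x : ℝ := ((j * q : ℕ) : ℝ) / p with hx
  have hnd : ¬ (p : ℤ) ∣ (q * j : ℤ) := by
    intro h
    have h' : p ∣ q * j := by exact_mod_cast h
    have := Nat.le_of_dvd hj (hco.symm.dvd_of_dvd_mul_left h')
    omega
  have hs : sn p (q * j) ≠ 0 := fun h => hnd ((sn_zero_iff p hp _).1 h)
  have e1 : sn p (q * j) = (-1) ^ ⌊x⌋ * sin (π * Int.fract x) := by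
    rw [← Real.sin_add_int_mul_pi]
    unfold sn
    congr 1
    have : π * Int.fract x + ⌊x⌋ * π = π * (Int.fract x + ⌊x⌋) := by ring
    rw [this, Int.fract_add_floor, hx]
    push_cast; ring
  have h0 : 0 ≤ sin (π * Int.fract x) := by
    apply Real.sin_nonneg_of_nonneg_of_le_pi
    · exact mul_nonneg pi_pos.le (Int.fract_nonneg x)
    · have := Int.fract_lt_one x
      nlinarith [pi_pos]
  have h1 : 0 < sin (π * Int.fract x) := by
    refine lt_of_le_of_ne h0 ?_
    intro h
    rw [← h, mul_zero] at e1
    exact hs e1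
  rw [e1]
  rcases Int.even_or_odd ⌊x⌋ with he | ho
  · rw [he.neg_one_zpow, one_mul, Real.sign_of_pos h1]
  · rw [ho.neg_one_zpow, neg_one_mul, Real.sign_of_neg (by linarith)]

noncomputable def ct (p : ℕ) (n : ℤ) : ℝ := cos (π * n / (2 * p)) / sin (π * n / (2 * p))

lemma sum_sn_nat (p : ℕ) (hp : 0 < p) (n : ℤ) :
    ∑ j ∈ range p, sn p (n * j) = if Odd n then ct p n else 0 := by
  have hp' : (p : ℝ) ≠ 0 := by exact_mod_cast hp.ne'
  have h := sum_sin_closed (π * n / p) p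
  have e1 : ∑ j ∈ range p, sn p (n * j) = ∑ j ∈ range p, sin (j * (π * n / p)) := by
    apply sum_congr rfl
    intro j _
    unfold sn; congr 1; push_cast; ring
  rw [← e1] at h
  have e2 : π * n / p / 2 = π * n / (2 * p) := by field_simp
  have e3 : (p : ℝ) * (π * n / p) - π * n / p / 2 = -(π * n / (2 * p)) + n * π := by
    field_simp; ring
  rw [e3, e2, Real.cos_add_int_mul_pi, Real.cos_neg] at h
  by_cases hz : sin (π * n / (2 * p)) = 0
  · have hd : ((2 * p : ℕ) : ℤ) ∣ n := by
      rw [← sin_zero_iff (2 * p) (by omega) n]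
      push_cast; exact hz
    have hev : ¬ Odd n := by
      obtain ⟨b, rfl⟩ := hd
      rw [Int.not_odd_iff_even]
      exact ⟨p * b, by push_cast; ring⟩
    rw [if_neg hev]
    apply sum_eq_zero
    intro j _
    rw [sn_zero_iff p hp]
    obtain ⟨b, rfl⟩ := hd
    exact ⟨2 * b * j, by push_cast; ring⟩
  · split_ifs with ho
    · rw [ho.neg_one_zpow] at h
      unfold ct
      field_simp
      linarith
    · rw [Int.not_odd_iff_even] at ho
      rw [ho.neg_one_zpow, one_mul, sub_self] at h
      rcases mul_eq_zero.1 h with h5 | h5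
      · exact absurd h5 (mul_ne_zero two_ne_zero hz)
      · exact h5

/-- The finite sine transform of `u ↦ sign (sn (c u))`. -/
noncomputable def HH (p : ℕ) (c m : ℤ) : ℝ :=
  ∑ j ∈ range (2 * p), Real.sign (sn p (c * j)) * sn p (m * j)

lemma HH_half (p : ℕ) (hp : 0 < p) (c m : ℤ) :
    HH p c m = 2 * ∑ j ∈ range p, Real.sign (sn p (c * j)) * sn p (m * j) := by
  unfold HH
  apply reflect_sum p hp (fun j : ℤ => Real.sign (sn p (c * j)) * sn p (m * j))
  · simp [sn]
  · have : sn p (m * p) = 0 := by rw [sn_zero_iff p hp]; exact Dvd.intro_left m rfl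
    simp [this]
  · intro a
    have e : ∀ b : ℤ, sn p (b * (2 * p - a)) = - sn p (b * a) := by
      intro b
      rw [← sn_neg, ← sn_per p hp (-(b * a)) b]
      congr 1; ring
    simp only [e, Real.sign_neg]
    ring

lemma HH_perm (p q : ℕ) (hp : 0 < p) (hco : IsCoprime (q : ℤ) ((2 * p : ℕ) : ℤ)) (n : ℤ) :
    HH p q (q * n) = if Odd n then 2 * ct p n else 0 := by
  have h1 : HH p q (q * n) = HH p 1 n := by
    unfold HH
    have := perm_sum (2 * p) (by omega) (fun j : ℤ => Real.sign (sn p (1 * j)) * sn p (n * j))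
      (by
        intro a
        have e : ∀ b : ℤ, sn p (b * (a + (2 * p : ℕ))) = sn p (b * a) := by
          intro b
          rw [← sn_per p hp (b * a) b]
          congr 1; push_cast; ring
        simp only [e]) q 0 hco
    rw [← this]
    apply sum_congr rfl
    intro j _
    congr 2
    · congr 1; ring
    · ring
  rw [h1, HH_half p hp]
  have h2 : ∑ j ∈ range p, Real.sign (sn p (1 * j)) * sn p (n * j) = ∑ j ∈ range p, sn p (n * j) := by
    apply sum_congr rfl
    intro j hj
    rw [mem_range] at hj
    rcases Nat.eq_zero_or_pos j with rfl | h
    · simp [sn]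
    · rw [Real.sign_of_pos, one_mul]
      apply sn_pos <;> omega
  rw [h2, sum_sn_nat p hp]
  split_ifs <;> simp

lemma odd_range (p : ℕ) (hp : Odd p) (A : ℤ → ℝ) :
    ∑ i ∈ range p, (if Odd (i : ℤ) then A i else 0)
      = ∑ n ∈ (Finset.Icc 1 (p - 2)).filter (fun n => Odd n), A n := by
  rw [← sum_filter]
  apply sum_congr _ (fun _ _ => rfl)
  ext i
  simp only [mem_filter, mem_range, mem_Icc]
  rw [Int.odd_coe_nat]
  obtain ⟨w, hw⟩ := hp
  constructor
  · rintro ⟨h1, ⟨v, hv⟩⟩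
    exact ⟨by omega, ⟨v, hv⟩⟩
  · rintro ⟨h1, ⟨v, hv⟩⟩
    exact ⟨by omega, ⟨v, hv⟩⟩

lemma sum_triple (p : ℕ) (e : ℕ → ℝ) (a : ℕ → ℕ → ℝ) :
    ∑ t ∈ range p ×ˢ range p ×ˢ range p, e t.1 * e t.2.1 * e t.2.2 *
      ∑ m ∈ range (2 * p), a m t.1 * a m t.2.1 * a m t.2.2 / a m 1
    = ∑ m ∈ range (2 * p), (∑ j ∈ range p, e j * a m j) ^ 3 / a m 1 := by
  simp only [mul_sum]
  rw [sum_comm]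
  apply sum_congr rfl
  intro m _
  have : (∑ j ∈ range p, e j * a m j) ^ 3
    = ∑ t ∈ range p ×ˢ range p ×ˢ range p,
        (e t.1 * a m t.1) * ((e t.2.1 * a m t.2.1) * (e t.2.2 * a m t.2.2)) := by
    rw [pow_succ', pow_two, sum_mul_sum, sum_product]
    rw [sum_mul_sum]
    apply sum_congr rfl
    intro j _
    rw [sum_product]
    apply sum_congr rfl
    intro k _
    rw [mul_sum]
  rw [this, sum_div]
  apply sum_congr rfl
  intro t _
  ring

lemma lhs_eq (p q : ℕ) (hp : Odd p) (hq : Odd q) (h0 : 0 < q) (hqp : q < p)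
    (hco : Nat.Coprime q p) :
    (∑ t ∈ (Finset.range p ×ˢ Finset.range p ×ˢ Finset.range p).filter
        (fun t => 0 < t.1 ∧ 0 < t.2.1 ∧ 0 < t.2.2 ∧
          t.1 < t.2.1 + t.2.2 ∧ t.2.1 < t.1 + t.2.2 ∧ t.2.2 < t.1 + t.2.1 ∧
          t.1 + t.2.1 + t.2.2 < 2 * p ∧ Odd (t.1 + t.2.1 + t.2.2)),
      (-1 : ℝ) ^ (⌊((t.1 * q : ℕ) : ℝ) / p⌋ + ⌊((t.2.1 * q : ℕ) : ℝ) / p⌋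
        + ⌊((t.2.2 * q : ℕ) : ℝ) / p⌋))
    = (2 / p) * ∑ n ∈ (Finset.Icc 1 (p - 2)).filter (fun n => Odd n),
        ct p n ^ 3 / sn p (q * n) := by
  have hpp : 0 < p := by omega
  have hp' : (p : ℝ) ≠ 0 := by exact_mod_cast hpp.ne'
  have hco2 : IsCoprime (q : ℤ) ((2 * p : ℕ) : ℤ) := by
    rw [Nat.isCoprime_iff_coprime]
    exact Nat.Coprime.mul_right (Nat.coprime_two_right.2 hq) hco
  set e : ℕ → ℝ := fun j => Real.sign (sn p (q * j)) with he
  have s1 := sum_triple p e (fun m j => sn p (m * j))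
  rw [sum_filter]
  have s2 : ∀ t ∈ range p ×ˢ range p ×ˢ range p,
      (if 0 < t.1 ∧ 0 < t.2.1 ∧ 0 < t.2.2 ∧
          t.1 < t.2.1 + t.2.2 ∧ t.2.1 < t.1 + t.2.2 ∧ t.2.2 < t.1 + t.2.1 ∧
          t.1 + t.2.1 + t.2.2 < 2 * p ∧ Odd (t.1 + t.2.1 + t.2.2) then
        (-1 : ℝ) ^ (⌊((t.1 * q : ℕ) : ℝ) / p⌋ + ⌊((t.2.1 * q : ℕ) : ℝ) / p⌋
        + ⌊((t.2.2 * q : ℕ) : ℝ) / p⌋) else 0)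
      = (1 / p) * (e t.1 * e t.2.1 * e t.2.2 *
      ∑ m ∈ range (2 * p), sn p (m * t.1) * sn p (m * t.2.1) * sn p (m * t.2.2) /
        sn p (m * (1 : ℕ))) := by
    rintro ⟨j, k, l⟩ ht
    simp only [mem_product, mem_range] at ht
    obtain ⟨hj, hk, hl⟩ := ht
    dsimp only
    have hz : sn p ((q : ℤ) * (0 : ℕ)) = 0 := by simp [sn]
    rcases Nat.eq_zero_or_pos j with rfl | hj0
    · simp [he, sn]
    rcases Nat.eq_zero_or_pos k with rfl | hk0
    · simp [he, sn]
    rcases Nat.eq_zero_or_pos l with rfl | hl0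
    · simp [he, sn]
    have hv := verlinde p j k l hj0 hk0 hl0 hj hk hl
    simp only [Nat.cast_one, mul_one]
    rw [hv]
    simp only [hj0, hk0, hl0, true_and]
    split_ifs
    · rw [zpow_add₀ (by norm_num), zpow_add₀ (by norm_num),
        sign_floor p q j hpp hco hj0 hj, sign_floor p q k hpp hco hk0 hk,
        sign_floor p q l hpp hco hl0 hl]
      simp only [he]
      field_simp
    · simp
  rw [sum_congr rfl s2, ← mul_sum]
  rw [s1]
  set F : ℤ → ℝ := fun m => (HH p q m / 2) ^ 3 / sn p m with hF
  have s3 : ∑ m ∈ range (2 * p), (∑ j ∈ range p, e j * sn p (m * j)) ^ 3 / sn p (m * (1 : ℕ))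
      = ∑ m ∈ range (2 * p), F m := by
    apply sum_congr rfl
    intro m _
    simp only [hF]
    rw [HH_half p hpp]
    simp [he]
  rw [s3, ← perm_sum (2 * p) (by omega) F ?_ q 0 hco2]
  swap
  · intro a
    simp only [hF, HH]
    have e1 : ∀ b : ℤ, sn p ((a + (2 * p : ℕ)) * b) = sn p (a * b) := by
      intro b
      rw [← sn_per p hpp (a * b) b]
      congr 1; push_cast; ring
    have e2 := e1 1
    rw [mul_one, mul_one] at e2
    rw [e2]
    simp only [e1]
  set P : ℤ → ℝ := fun n => if Odd n then ct p n ^ 3 / sn p (q * n) else 0 with hP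
  have s4 : ∑ n ∈ range (2 * p), F (q * n + 0) = ∑ n ∈ range (2 * p), P n := by
    apply sum_congr rfl
    intro n _
    simp only [hF, hP, add_zero]
    rw [HH_perm p q hpp hco2]
    split_ifs <;> simp
  rw [s4, reflect_sum p hpp P, odd_range p hp (fun n => ct p n ^ 3 / sn p (q * n))]
  · ring
  · simp [hP]
  · have : ct p p = 0 := by
      unfold ct
      have : π * ((p : ℤ) : ℝ) / (2 * p) = π / 2 := by push_cast; field_simp
      rw [this, Real.cos_pi_div_two, zero_div]
    simp [hP, this]
  · intro a
    have o : Odd (2 * (p : ℤ) - a) ↔ Odd a := by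
      constructor
      · rintro ⟨w, hw⟩; exact ⟨p - w - 1, by omega⟩
      · rintro ⟨w, hw⟩; exact ⟨p - w - 1, by omega⟩
    have e1 : sn p (q * (2 * p - a)) = - sn p (q * a) := by
      rw [← sn_neg, ← sn_per p hpp (-(q * a)) q]
      congr 1; ring
    have e2 : ct p (2 * p - a) = - ct p a := by
      unfold ct
      have : π * ((2 * p - a : ℤ) : ℝ) / (2 * p) = π - π * a / (2 * p) := by
        push_cast; field_simp
      rw [this, Real.cos_pi_sub, Real.sin_pi_sub, neg_div]
    simp only [hP, o, e1, e2]
    split_ifs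
    · ring
    · rfl


lemma sum_two_mul (p : ℕ) (Q : ℤ → ℝ) :
    ∑ n ∈ range (2 * p), Q n = ∑ i ∈ range p, (Q (2 * i) + Q (2 * i + 1)) := by
  induction p with
  | zero => simp
  | succ n ih =>
    rw [show 2 * (n + 1) = 2 * n + 1 + 1 by ring, sum_range_succ, sum_range_succ, ih,
      sum_range_succ]
    push_cast; ring

lemma K_sum (p : ℕ) (hp : Odd p) (hpp : 0 < p) :
    ∑ n ∈ range (2 * p), (if Odd (n : ℤ) then cos (π * (n : ℤ) / p) / sn p n ^ 2 else 0)
      = ((p : ℝ) ^ 2 - 1) / 6 := by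
  have hp' : (p : ℝ) ≠ 0 := by exact_mod_cast hpp.ne'
  obtain ⟨w, hw⟩ := hp
  set K : ℤ → ℝ := fun n => cos (π * n / p) / sn p n ^ 2 with hK
  have hsn : ∀ n, sn p (n + p) = - sn p n := by
    intro n; unfold sn
    rw [← Real.sin_add_pi]; congr 1; push_cast; field_simp
  have hKp : ∀ n, K (n + p) = - K n := by
    intro n
    simp only [hK, hsn]
    have : cos (π * ((n + p : ℤ) : ℝ) / p) = - cos (π * n / p) := by
      rw [← Real.cos_add_pi]; congr 1; push_cast; field_simp
    rw [this]; ring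
  rw [sum_two_mul p (fun n => if Odd n then K n else 0)]
  have h1 : ∀ i ∈ range p, ((if Odd (2 * (i : ℤ)) then K (2 * i) else 0)
      + (if Odd (2 * (i : ℤ) + 1) then K (2 * i + 1) else 0))
      = - (fun i : ℤ => K (2 * i)) (1 * i + (w + 1 : ℤ)) := by
    intro i _
    have o1 : ¬ Odd (2 * (i : ℤ)) := by simp
    have o2 : Odd (2 * (i : ℤ) + 1) := ⟨i, rfl⟩
    rw [if_neg o1, if_pos o2, zero_add, eq_neg_iff_add_eq_zero]
    have : 2 * (1 * (i : ℤ) + (w + 1)) = 2 * i + 1 + p := by rw [hw]; push_cast; ring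
    simp only [this, hKp]
    ring
  rw [sum_congr rfl h1, sum_neg_distrib]
  rw [perm_sum p hpp (fun i : ℤ => K (2 * i)) ?_ 1 (w + 1) isCoprime_one_left]
  swap
  · intro a
    have : 2 * (a + (p : ℤ)) = 2 * a + p + p := by ring
    simp only [this, hKp, neg_neg]
  set C : ℤ → ℝ := fun n => 1 / sn p n ^ 2 with hC
  have hCs : ∑ i ∈ range p, C i = ((p : ℝ) ^ 2 - 1) / 3 := by
    rw [← csc_sum p hpp]
    simp [hC, sn]
  have hC2 : ∑ i ∈ range p, C (2 * i + 0) = ((p : ℝ) ^ 2 - 1) / 3 := by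
    rw [← hCs]
    apply perm_sum p hpp
    · intro a; simp only [hC, hsn]; ring
    · exact ⟨-w, 1, by rw [hw]; push_cast; ring⟩
  have h2 : ∀ i ∈ range p, K (2 * i) = (1 / 2) * C i - C (2 * i + 0) := by
    intro i hi
    simp only [hK, hC, add_zero]
    have e1 : sn p (2 * i) = 2 * sin (π * i / p) * cos (π * i / p) := by
      rw [← Real.sin_two_mul]; unfold sn; congr 1; push_cast; ring
    have e2 : cos (π * ((2 * i : ℤ) : ℝ) / p) = 2 * cos (π * i / p) ^ 2 - 1 := by
      rw [← Real.cos_two_mul]; congr 1; push_cast; ring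
    have e3 : sn p i = sin (π * i / p) := by simp [sn]
    by_cases hs : sin (π * i / p) = 0
    · rw [e1, e3, hs]; simp
    · have hc : cos (π * i / p) ≠ 0 := by
        intro hc
        rw [hc, mul_zero, sn_zero_iff p hpp] at e1
        have h3 : (p : ℤ) ∣ i := by
          have hcop : IsCoprime (p : ℤ) 2 := ⟨1, -w, by rw [hw]; push_cast; ring⟩
          exact hcop.dvd_of_dvd_mul_left e1
        rw [← sn_zero_iff p hpp, e3] at h3
        exact hs h3
      rw [e1, e2, e3]
      field_simp
  rw [sum_congr rfl h2, sum_sub_distrib, ← mul_sum, hCs, hC2]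
  ring

lemma cos_sum (p q : ℕ) (hp : Odd p) (hq : Odd q) (hpp : 0 < p)
    (hco : Nat.Coprime q p) :
    ∑ n ∈ (Finset.Icc 1 (p - 2)).filter (fun n => Odd n),
      cos (π * ((q * (n : ℤ) : ℤ) : ℝ) / p) / sn p (q * n) ^ 2 = ((p : ℝ) ^ 2 - 1) / 12 := by
  have hp' : (p : ℝ) ≠ 0 := by exact_mod_cast hpp.ne'
  have hco2 : IsCoprime (q : ℤ) ((2 * p : ℕ) : ℤ) := by
    rw [Nat.isCoprime_iff_coprime]
    exact Nat.Coprime.mul_right (Nat.coprime_two_right.2 hq) hco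
  set Q : ℤ → ℝ := fun n => if Odd n then cos (π * n / p) / sn p n ^ 2 else 0 with hQ
  have oq : Odd (q : ℤ) := by exact_mod_cast hq
  have hper : ∀ a b : ℤ, Q (a + 2 * p * b) = Q a := by
    intro a b
    have o : Odd (a + 2 * (p : ℤ) * b) ↔ Odd a := by
      rw [Int.odd_add]
      have : Even (2 * (p : ℤ) * b) := ⟨p * b, by ring⟩
      simp [this]
    have : π * ((a + 2 * p * b : ℤ) : ℝ) / p = π * a / p + b * (2 * π) := by
      push_cast; field_simp
    simp only [hQ, o, sn_per p hpp, this, Real.cos_add_int_mul_two_pi]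
  have h1 := odd_range p hp (fun n => cos (π * ((q * n : ℤ) : ℝ) / p) / sn p (q * n) ^ 2)
  rw [← h1]
  have h2 : ∀ i ∈ range p, (if Odd (i : ℤ) then
      cos (π * ((q * (i : ℤ) : ℤ) : ℝ) / p) / sn p (q * i) ^ 2 else 0)
      = (fun n : ℤ => Q (q * n)) i := by
    intro i _
    have : Odd ((q : ℤ) * i) ↔ Odd (i : ℤ) := by rw [Int.odd_mul]; simp [oq]
    simp only [hQ, this]
  have h3 := reflect_sum p hpp (fun n : ℤ => Q (q * n)) (by simp [hQ])
    (by
      have : sn p (q * p) = 0 := by rw [sn_zero_iff p hpp]; exact Dvd.intro_left _ rfl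
      simp [hQ, this])
    (by
      intro a
      have e : (q : ℤ) * (2 * p - a) = -(q * a) + 2 * p * q := by ring
      rw [e, hper]
      simp only [hQ, odd_neg, sn_neg]
      have : π * ((-((q : ℤ) * a) : ℤ) : ℝ) / p = -(π * ((q * a : ℤ) : ℝ) / p) := by
        push_cast; ring
      rw [this, Real.cos_neg]
      simp)
  have h4 := perm_sum (2 * p) (by omega) Q (by
    intro a
    rw [← hper a 1]; congr 1; push_cast; ring) q 0 hco2
  have h5 : ∑ n ∈ range (2 * p), Q n = ((p : ℝ) ^ 2 - 1) / 6 := K_sum p hp hpp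
  simp only [add_zero] at h4
  rw [sum_congr rfl h2]
  linarith

lemma f_eq (n p q : ℕ) (hpp : 0 < p) :
    fnpq n p q = 8 * p * sn p (q * n) * cos (π * n / (2 * p)) ^ 3
      + 8 * cos (π * ((q * (n : ℤ) : ℤ) : ℝ) / p) * sin (π * n / (2 * p)) ^ 3 := by
  have hp' : (p : ℝ) ≠ 0 := by exact_mod_cast hpp.ne'
  unfold fnpq sn
  set x : ℝ := π * n / (2 * p) with hx
  set y : ℝ := π * ((q * (n : ℤ) : ℤ) : ℝ) / p with hy
  have e1 : (2 * (q : ℝ) - 1) * n * π / (2 * p) = y - x := by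
    rw [hx, hy]; push_cast; field_simp
  have e2 : (2 * (q : ℝ) - 3) * n * π / (2 * p) = y - 3 * x := by
    rw [hx, hy]; push_cast; field_simp
  have e3 : (2 * (q : ℝ) + 3) * n * π / (2 * p) = y + 3 * x := by
    rw [hx, hy]; push_cast; field_simp
  have e4 : (2 * (q : ℝ) + 1) * n * π / (2 * p) = y + x := by
    rw [hx, hy]; push_cast; field_simp
  rw [e1, e2, e3, e4, Real.sin_add, Real.sin_add, Real.sin_sub, Real.sin_sub,
    Real.sin_three_mul, Real.cos_three_mul]
  ring

/-- Trigonometric formula for the genus-2 signature: for `0 < q < p`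
coprime odd integers,
`Σ_{(j,k,ℓ)∈Δ_p} (-1)^{⌊jq/p⌋+⌊kq/p⌋+⌊ℓq/p⌋}
  = (1-p²)/(6p²) + (1/(4p²)) Σ_{n odd, 1≤n≤p-2} f(n,p,q)/(sin³(nπ/2p) sin²(qnπ/p))`. -/
theorem stmt_6 (p q : ℕ) (hp : Odd p) (hq : Odd q) (h0 : 0 < q) (hqp : q < p)
    (hco : Nat.Coprime q p) :
    (∑ t ∈ (Finset.range p ×ˢ Finset.range p ×ˢ Finset.range p).filter
        (fun t => 0 < t.1 ∧ 0 < t.2.1 ∧ 0 < t.2.2 ∧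
          t.1 < t.2.1 + t.2.2 ∧ t.2.1 < t.1 + t.2.2 ∧ t.2.2 < t.1 + t.2.1 ∧
          t.1 + t.2.1 + t.2.2 < 2 * p ∧ Odd (t.1 + t.2.1 + t.2.2)),
      (-1 : ℝ) ^ (⌊((t.1 * q : ℕ) : ℝ) / p⌋ + ⌊((t.2.1 * q : ℕ) : ℝ) / p⌋
        + ⌊((t.2.2 * q : ℕ) : ℝ) / p⌋))
    = (1 - (p : ℝ) ^ 2) / (6 * (p : ℝ) ^ 2) +
      (1 / (4 * (p : ℝ) ^ 2)) *
        ∑ n ∈ (Finset.Icc 1 (p - 2)).filter (fun n => Odd n),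
          fnpq n p q /
            (Real.sin (n * π / (2 * p)) ^ 3 * Real.sin (q * n * π / p) ^ 2) := by
  have hpp : 0 < p := by omega
  have hp' : (p : ℝ) ≠ 0 := by exact_mod_cast hpp.ne'
  rw [lhs_eq p q hp hq h0 hqp hco]
  have h1 : ∀ n ∈ (Finset.Icc 1 (p - 2)).filter (fun n => Odd n),
      fnpq n p q / (Real.sin (n * π / (2 * p)) ^ 3 * Real.sin (q * n * π / p) ^ 2)
      = 8 * p * (ct p n ^ 3 / sn p (q * n))
        + 8 * (cos (π * ((q * (n : ℤ) : ℤ) : ℝ) / p) / sn p (q * n) ^ 2) := by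
    intro n hn
    simp only [mem_filter, mem_Icc] at hn
    obtain ⟨⟨hn1, hn2⟩, -⟩ := hn
    have e1 : (n : ℝ) * π / (2 * p) = π * n / (2 * p) := by ring
    have e2 : Real.sin (q * n * π / p) = sn p (q * n) := by
      unfold sn; congr 1; push_cast; ring
    have hx : sin (π * n / (2 * p)) ≠ 0 := by
      have := (sin_zero_iff (2 * p) (by omega) n).not.2 (by
        intro h
        have := Nat.le_of_dvd hn1 (by exact_mod_cast h)
        omega)
      push_cast at this
      exact this
    have hy : sn p (q * n) ≠ 0 := by
      rw [Ne, sn_zero_iff p hpp]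
      intro h
      have h' : p ∣ q * n := by exact_mod_cast h
      have := Nat.le_of_dvd hn1 (hco.symm.dvd_of_dvd_mul_left h')
      omega
    rw [e1, e2, f_eq n p q hpp]
    unfold ct
    simp only [Int.cast_natCast]
    generalize sin (π * (n : ℝ) / (2 * p)) = X at hx ⊢
    field_simp
  rw [sum_congr rfl h1, sum_add_distrib, ← mul_sum, ← mul_sum, cos_sum p q hp hq hpp hco]
  field_simp
  ring
end

section
/- Let θ be a diophantine irrational real number. Then the series Σ_{n ≥ 1, n odd} 1/(n³ |sin(nπθ)|) converges; in particular the series defining Λ(θ) converges absolutely. -/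
open Real

/-- A real number `θ` is diophantine if for every `ε > 0` there is `C > 0` with
`|nθ - ℓ| ≥ C·n^{-1-ε}` for all integers `n ≥ 1` and all `ℓ ∈ ℤ`. -/
def Diophantine (θ : ℝ) : Prop :=
  ∀ ε : ℝ, 0 < ε → ∃ C : ℝ, 0 < C ∧ ∀ n : ℕ, 1 ≤ n → ∀ ℓ : ℤ,
    C * (n : ℝ) ^ (-1 - ε) ≤ |(n : ℝ) * θ - (ℓ : ℝ)|

lemma sin_lower (x : ℝ) : 2 * |x - round x| ≤ |Real.sin (x * π)| := by
  have h1 : |(x - round x) * π| ≤ π / 2 := by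
    rw [abs_mul, abs_of_pos Real.pi_pos]
    have := abs_sub_round x
    nlinarith [Real.pi_pos]
  have h2 := Real.mul_abs_le_abs_sin h1
  have h3 : |Real.sin ((x - round x) * π)| = |Real.sin (x * π)| := by
    rw [sub_mul, Real.sin_sub_int_mul_pi, abs_mul]
    simp
  rw [h3, abs_mul, abs_of_pos Real.pi_pos] at h2
  have h4 : 2 / π * (|x - round x| * π) = 2 * |x - round x| := by
    field_simp
  linarith

/-- For a diophantine irrational `θ`, the series
`Σ_{n ≥ 1 odd} 1/(n³|sin(nπθ)|)` converges; in particular the series defining `Λ(θ)`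
converges absolutely. -/
theorem stmt_7 (θ : ℝ) (hirr : Irrational θ) (hdio : Diophantine θ) :
    Summable (fun n : ℕ => if Odd n then 1 / ((n : ℝ) ^ 3 * |Real.sin (n * π * θ)|) else 0)
    ∧ Summable (fun n : ℕ =>
        |if Odd n then 1 / ((n : ℝ) ^ 3 * Real.sin (n * π * θ)) else 0|) := by
  have key : Summable
      (fun n : ℕ => if Odd n then 1 / ((n : ℝ) ^ 3 * |Real.sin (n * π * θ)|) else 0) := by
    obtain ⟨C, hC, h⟩ := hdio (1 / 2) (by norm_num)
    have hs : Summable (fun n : ℕ => 1 / (2 * C) * (n : ℝ) ^ (-(3 / 2) : ℝ)) :=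
      (Real.summable_nat_rpow.2 (by norm_num)).mul_left _
    refine Summable.of_nonneg_of_le (fun n => ?_) (fun n => ?_) hs
    · split_ifs <;> positivity
    · split_ifs with ho
      · have hn : 1 ≤ n := ho.pos
        have hn' : (0 : ℝ) < n := by exact_mod_cast hn
        have h1 := h n hn (round ((n : ℝ) * θ))
        have h2 := sin_lower ((n : ℝ) * θ)
        rw [show (n : ℝ) * θ * π = n * π * θ by ring] at h2
        have h3 : (n : ℝ) ^ 3 * (n : ℝ) ^ (-1 - 1 / 2 : ℝ) = (n : ℝ) ^ (3 / 2 : ℝ) := by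
          rw [← Real.rpow_natCast, ← Real.rpow_add hn']
          norm_num
        have h4 : 2 * C * (n : ℝ) ^ (3 / 2 : ℝ) ≤ (n : ℝ) ^ 3 * |Real.sin (n * π * θ)| := by
          rw [← h3]
          have : (0 : ℝ) < (n : ℝ) ^ 3 := by positivity
          nlinarith
        calc _ ≤ 1 / (2 * C * (n : ℝ) ^ (3 / 2 : ℝ)) :=
              one_div_le_one_div_of_le (by positivity) h4
          _ = _ := by
            rw [Real.rpow_neg hn'.le]
            field_simp
      · positivity
  refine ⟨key, key.congr fun n => ?_⟩
  split_ifs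
  · rw [abs_div, abs_mul, abs_one, abs_of_nonneg (by positivity : (0 : ℝ) ≤ (n : ℝ) ^ 3)]
  · simp
end

section
/- Let θ ∈ (0,1) be a diophantine irrational real number, and let (q_k), (p_k) be sequences of integers with 0 < q_k < p_k, gcd(q_k, p_k) = 1, p_k → ∞, and |θ - q_k/p_k| < 1/p_k² for all k. Define S⁽¹⁾(q,p) := (1/p³) · Σ_{n=1, n odd}^{p-2} cos(nπ/(2p)) / ( sin³(nπ/(2p)) · sin(qnπ/p) ). Then lim_{k→∞} S⁽¹⁾(q_k, p_k) = (8/π³) · Σ_{n ≥ 1, n odd} 1/(n³ sin(nπθ)). -/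
open Real Finset Filter

/-- The sum `S⁽¹⁾(q,p)` from the proof of Theorem 4.1. -/
noncomputable def S1 (q p : ℕ) : ℝ :=
  (1 / (p : ℝ) ^ 3) * ∑ n ∈ (Finset.Icc 1 (p - 2)).filter (fun n => Odd n),
    Real.cos (n * π / (2 * p)) /
      (Real.sin (n * π / (2 * p)) ^ 3 * Real.sin (q * n * π / p))

theorem aux_sin (x : ℝ) (d : ℝ) (h : ∀ l : ℤ, d ≤ |x - l|) : d ≤ |Real.sin (x * π)| := by
  have h1 := h (round x)
  have h2 := abs_sub_round x
  have hpi := Real.pi_pos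
  have h3 : |Real.sin (x * π)| = |Real.sin ((x - round x) * π)| := by
    rw [sub_mul, Real.sin_sub_int_mul_pi, abs_mul]
    have : |((-1 : ℝ) ^ (round x))| = 1 := by
      rw [abs_zpow]; simp
    rw [this, one_mul]
  rw [h3]
  have h4 : |(x - round x) * π| = |x - round x| * π := by
    rw [abs_mul, abs_of_pos hpi]
  have h5 := Real.mul_abs_le_abs_sin (x := (x - round x) * π) (by rw [h4]; nlinarith)
  rw [h4] at h5
  have h6 : 2 / π * (|x - round x| * π) = 2 * |x - round x| := by field_simp
  rw [h6] at h5
  have := abs_nonneg (x - round x)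
  linarith

theorem aux_lower (θ : ℝ) (hdio : Diophantine θ) : ∃ c : ℝ, 0 < c ∧
    ∀ q p n : ℕ, Nat.Coprime q p → |θ - (q : ℝ) / (p : ℝ)| < 1 / (p : ℝ) ^ 2 →
      1 ≤ n → n < p → c * (n : ℝ) ^ (-(3 / 2) : ℝ) ≤ |Real.sin (q * n * π / p)| := by
  obtain ⟨C, hC, hd⟩ := hdio (1 / 2) (by norm_num)
  refine ⟨min (C / 2) 1, by positivity, ?_⟩
  intro q p n hco hap hn hnp
  set c := min (C / 2) 1 with hc
  have hc0 : 0 < c := by positivity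
  have hc1 : c ≤ 1 := min_le_right _ _
  have hc2 : c ≤ C / 2 := min_le_left _ _
  have hp0 : (0 : ℝ) < p := by exact_mod_cast (by omega : 0 < p)
  have hn1 : (1 : ℝ) ≤ n := by exact_mod_cast hn
  have hrw : (q : ℝ) * n * π / p = ((n : ℝ) * (q / p)) * π := by ring
  rw [hrw]
  apply aux_sin
  intro l
  set u := (n : ℝ) ^ (-(3 / 2) : ℝ) with hu
  have hu0 : 0 < u := by positivity
  have hun : u * n ≤ 1 := by
    have : u * n = (n : ℝ) ^ (-(1 / 2) : ℝ) := by
      rw [hu]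
      nth_rw 2 [← Real.rpow_one (n : ℝ)]
      rw [← Real.rpow_add (by linarith)]; norm_num
    rw [this]
    exact Real.rpow_le_one_of_one_le_of_nonpos hn1 (by norm_num)
  have h1 := hd n hn l
  rw [show (-1 - 1 / 2 : ℝ) = -(3 / 2) by norm_num, ← hu] at h1
  by_cases hcase : (n : ℝ) / p ^ 2 ≤ c * u
  · have h2 : |(n : ℝ) * θ - n * (q / p)| ≤ n / p ^ 2 := by
      rw [← mul_sub, abs_mul, abs_of_pos (by linarith : (0 : ℝ) < n), div_eq_mul_one_div (n : ℝ)]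
      exact mul_le_mul_of_nonneg_left hap.le (by linarith)
    have h3 := abs_sub_le ((n : ℝ) * θ) (n * (q / p)) l
    nlinarith
  · push Not at hcase
    rw [lt_div_iff₀ (by positivity)] at hcase
    have h2 : (p * (c * u)) ^ 2 ≤ 1 ^ 2 := by
      have : (p * (c * u)) ^ 2 = (c * u) * (c * u * p ^ 2) := by ring
      rw [this]
      calc _ ≤ (c * u) * n := by gcongr
        _ = c * (u * n) := by ring
        _ ≤ 1 * 1 := by gcongr
        _ = 1 ^ 2 := by norm_num
    have h3 : p * (c * u) ≤ 1 := le_trans (le_abs_self _) (abs_le_of_sq_le_sq h2 (by norm_num))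
    have h4 : (n : ℝ) * (q / p) - l = ((n * q - l * p : ℤ) : ℝ) / p := by
      push_cast; field_simp
    have h5 : (n * q - l * p : ℤ) ≠ 0 := by
      intro h0
      have : (p : ℤ) ∣ (n * q : ℕ) := ⟨l, by push_cast; linarith⟩
      have h6 : p ∣ n * q := by exact_mod_cast this
      have := Nat.le_of_dvd (by omega) (hco.symm.dvd_of_dvd_mul_right h6)
      omega
    have h6 : (1 : ℝ) ≤ |((n * q - l * p : ℤ) : ℝ)| := by
      exact_mod_cast Int.one_le_abs h5
    rw [h4, abs_div, abs_of_pos hp0, le_div_iff₀ hp0]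
    linarith

theorem aux_term (θ : ℝ) (hirr : Irrational θ) (q p : ℕ → ℕ)
    (hptop : Tendsto (fun k => p k) atTop atTop)
    (hlim : Tendsto (fun k => (q k : ℝ) / (p k : ℝ)) atTop (nhds θ)) (n : ℕ) (hn : 1 ≤ n) :
    Tendsto (fun k => (1 / (p k : ℝ) ^ 3) * (Real.cos (n * π / (2 * p k)) /
      (Real.sin (n * π / (2 * p k)) ^ 3 * Real.sin (q k * n * π / p k)))) atTop
      (nhds ((8 / π ^ 3) * (1 / ((n : ℝ) ^ 3 * Real.sin (n * π * θ))))) := by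
  have hn0 : (n : ℝ) ≠ 0 := by positivity
  have hpr : Tendsto (fun k => (p k : ℝ)) atTop atTop :=
    tendsto_natCast_atTop_atTop.comp hptop
  have hx : Tendsto (fun k => n * π / (2 * (p k : ℝ))) atTop (nhds 0) :=
    Tendsto.const_div_atTop (hpr.const_mul_atTop (by norm_num)) _
  have hcos := (Real.continuous_cos.tendsto 0).comp hx
  have hsinc := (Real.continuous_sinc.tendsto 0).comp hx
  rw [Real.cos_zero] at hcos
  rw [Real.sinc_zero] at hsinc
  have hsin := (Real.continuous_sin.tendsto _).comp (hlim.mul_const (n * π : ℝ))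
  have hs0 : Real.sin (θ * (n * π)) ≠ 0 := by
    rw [Real.sin_ne_zero_iff]
    intro m hm
    have : (m : ℝ) = n * θ := by
      apply mul_right_cancel₀ Real.pi_ne_zero
      linarith
    exact (hirr.natCast_mul (by omega : n ≠ 0)).ne_int m this.symm
  have hmain := hcos.div (((hsinc.const_mul (n * π / 2)).pow 3).mul hsin) (by
    have := Real.pi_ne_zero
    positivity)
  have hval : (1 : ℝ) / ((n * π / 2 * 1) ^ 3 * Real.sin (θ * (n * π)))
      = (8 / π ^ 3) * (1 / ((n : ℝ) ^ 3 * Real.sin (n * π * θ))) := by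
    rw [show θ * (n * π) = n * π * θ by ring] at hs0 ⊢
    have := Real.pi_ne_zero
    field_simp
    norm_num
  rw [hval] at hmain
  refine hmain.congr' ?_
  filter_upwards [hpr.eventually_gt_atTop 0] with k hk
  have hy : n * π / (2 * (p k : ℝ)) ≠ 0 := by
    have := Real.pi_pos
    positivity
  simp only [Function.comp, Pi.div_apply]
  rw [Real.sinc_of_ne_zero hy]
  rw [show (q k : ℝ) / p k * (n * π) = q k * n * π / p k by ring]
  have h2 : n * π / 2 * (Real.sin (n * π / (2 * (p k : ℝ))) / (n * π / (2 * (p k : ℝ))))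
      = p k * Real.sin (n * π / (2 * (p k : ℝ))) := by
    have := Real.pi_ne_zero
    field_simp
  rw [h2]
  generalize Real.sin (n * π / (2 * (p k : ℝ))) = a
  generalize Real.sin (q k * n * π / (p k : ℝ)) = b
  generalize Real.cos (n * π / (2 * (p k : ℝ))) = d
  rw [mul_pow, mul_assoc, div_mul_div_comm, one_mul]

theorem aux_bound (θ : ℝ) (hdio : Diophantine θ) : ∃ c : ℝ, 0 < c ∧
    ∀ q p n : ℕ, Nat.Coprime q p → |θ - (q : ℝ) / (p : ℝ)| < 1 / (p : ℝ) ^ 2 →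
      1 ≤ n → n < p → |(1 / (p : ℝ) ^ 3) * (Real.cos (n * π / (2 * p)) /
      (Real.sin (n * π / (2 * p)) ^ 3 * Real.sin (q * n * π / p)))|
        ≤ c * (n : ℝ) ^ (-(3 / 2) : ℝ) := by
  obtain ⟨c, hc, h⟩ := aux_lower θ hdio
  refine ⟨1 / c, by positivity, ?_⟩
  intro q p n hco hap hn hnp
  have h1 := h q p n hco hap hn hnp
  have hpi := Real.pi_pos
  have hp0 : (0 : ℝ) < p := by exact_mod_cast (by omega : 0 < p)
  have hn1 : (0 : ℝ) < n := by exact_mod_cast hn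
  have hnp' : (n : ℝ) < p := by exact_mod_cast hnp
  have h2 : (n : ℝ) / p ≤ Real.sin (n * π / (2 * p)) := by
    have := Real.mul_le_sin (x := n * π / (2 * p)) (by positivity) (by
      rw [div_le_div_iff₀ (by positivity) (by positivity)]
      nlinarith)
    convert this using 1
    field_simp
  have h3 : 0 < (n : ℝ) / p := by positivity
  have h4 : 0 < c * (n : ℝ) ^ (-(3 / 2) : ℝ) := by positivity
  rw [abs_mul, abs_div (Real.cos _), abs_mul, abs_pow, abs_of_pos (lt_of_lt_of_le h3 h2),
    abs_of_pos (by positivity : 0 < 1 / (p : ℝ) ^ 3)]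
  calc _ ≤ 1 / (p : ℝ) ^ 3 * (1 / (((n : ℝ) / p) ^ 3 * (c * (n : ℝ) ^ (-(3 / 2) : ℝ)))) := by
        gcongr
        · exact Real.abs_cos_le_one _
        · exact pow_nonneg (h3.le.trans h2) 3
    _ = 1 / c * (1 / ((n : ℝ) ^ (3 : ℝ) * (n : ℝ) ^ (-(3 / 2) : ℝ))) := by
        rw [show ((n : ℝ) ^ (3 : ℝ)) = (n : ℝ) ^ (3 : ℕ) by
          rw [← Real.rpow_natCast]; norm_num]
        field_simp
    _ = _ := by
        rw [← Real.rpow_add hn1, one_div ((n : ℝ) ^ _), ← Real.rpow_neg hn1.le]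
        norm_num

/-- `S⁽¹⁾(q_k,p_k) → (8/π³) Σ_{n odd} 1/(n³ sin(nπθ))`. -/
theorem stmt_8 (θ : ℝ) (hθ : θ ∈ Set.Ioo (0 : ℝ) 1) (hirr : Irrational θ)
    (hdio : Diophantine θ) (q p : ℕ → ℕ)
    (hqpos : ∀ k, 0 < q k) (hqp : ∀ k, q k < p k)
    (hco : ∀ k, Nat.Coprime (q k) (p k))
    (hptop : Tendsto (fun k => p k) atTop atTop)
    (happrox : ∀ k, |θ - (q k : ℝ) / (p k : ℝ)| < 1 / (p k : ℝ) ^ 2) :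
    Tendsto (fun k => S1 (q k) (p k)) atTop
      (nhds ((8 / π ^ 3) *
        ∑' n : ℕ, if Odd n then 1 / ((n : ℝ) ^ 3 * Real.sin (n * π * θ)) else 0)) := by
  have hlim : Tendsto (fun k => (q k : ℝ) / (p k : ℝ)) atTop (nhds θ) := by
    have hpr : Tendsto (fun k => (p k : ℝ)) atTop atTop :=
      tendsto_natCast_atTop_atTop.comp hptop
    rw [tendsto_iff_dist_tendsto_zero]
    refine squeeze_zero (fun _ => dist_nonneg) (g := fun k => 1 / (p k : ℝ) ^ 2) ?_ ?_
    · intro k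
      rw [dist_comm, Real.dist_eq]
      exact (happrox k).le
    · exact Tendsto.const_div_atTop ((tendsto_pow_atTop (by norm_num)).comp hpr) _
  obtain ⟨c, hc, hb⟩ := aux_bound θ hdio
  let f : ℕ → ℕ → ℝ := fun k n => (1 / (p k : ℝ) ^ 3) * (Real.cos (n * π / (2 * p k)) /
      (Real.sin (n * π / (2 * p k)) ^ 3 * Real.sin (q k * n * π / p k)))
  let F : ℕ → ℕ → ℝ := fun k n =>
    if n ∈ (Finset.Icc 1 (p k - 2)).filter (fun n => Odd n) then f k n else 0
  have hS : ∀ k, S1 (q k) (p k) = ∑' n, F k n := by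
    intro k
    rw [tsum_eq_sum (s := (Finset.Icc 1 (p k - 2)).filter (fun n => Odd n))
      (fun n hn => if_neg hn)]
    rw [S1, Finset.mul_sum]
    exact Finset.sum_congr rfl fun n hn => (if_pos hn).symm
  simp only [hS]
  rw [← tsum_mul_left]
  refine tendsto_tsum_of_dominated_convergence
    (bound := fun n : ℕ => c * (n : ℝ) ^ (-(3 / 2) : ℝ)) ?_ ?_ ?_
  · exact (Real.summable_nat_rpow.2 (by norm_num)).mul_left c
  · intro n
    by_cases hn : Odd n
    · rw [if_pos hn]
      have hn1 : 1 ≤ n := hn.pos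
      refine (aux_term θ hirr q p hptop hlim n hn1).congr' ?_
      filter_upwards [hptop.eventually_ge_atTop (n + 2)] with k hk
      have : n ∈ (Finset.Icc 1 (p k - 2)).filter (fun n => Odd n) := by
        simp only [Finset.mem_filter, Finset.mem_Icc]
        exact ⟨⟨hn1, by omega⟩, hn⟩
      exact (if_pos this).symm
    · rw [if_neg hn, mul_zero]
      have : ∀ k, F k n = 0 := fun k => if_neg (by simp [hn])
      simp only [this]
      exact tendsto_const_nhds
  · refine Eventually.of_forall fun k n => ?_
    by_cases hn : n ∈ (Finset.Icc 1 (p k - 2)).filter (fun n => Odd n)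
    · simp only [F, if_pos hn, Real.norm_eq_abs]
      simp only [Finset.mem_filter, Finset.mem_Icc] at hn
      exact hb (q k) (p k) n (hco k) (happrox k) hn.1.1 (by omega)
    · simp only [F, if_neg hn, norm_zero]
      positivity
end

section
/- Let 0 < q < p be coprime integers and let M be an integer with 1 ≤ M ≤ p. Then | (1/p³) · Σ_{n=M, n odd}^{p-2} cos(qnπ/p) / ( sin²(nπ/(2p)) · sin²(qnπ/p) ) | ≤ (ζ(2)/2) · p / M², where ζ(2) = π²/6 and the sum runs over odd integers n with M ≤ n ≤ p-2. -/
open Real Finset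

lemma aux_sin_mod (p m : ℕ) (hp : 0 < p) :
    Real.sin (((m % p : ℕ) : ℝ) * π / p) ^ 2 = Real.sin ((m : ℝ) * π / p) ^ 2 := by
  have hp' : (p : ℝ) ≠ 0 := by positivity
  have h : (m : ℝ) * π / p = ((m % p : ℕ) : ℝ) * π / p + ((m / p : ℕ) : ℝ) * π := by
    have h1 : (m : ℝ) = ((m % p : ℕ) : ℝ) + p * ((m / p : ℕ) : ℝ) := by
      exact_mod_cast (Nat.mod_add_div m p).symm
    rw [h1]
    field_simp
  rw [h, Real.sin_add_nat_mul_pi, mul_pow, ← pow_mul, mul_comm (m / p) 2, pow_mul]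
  simp

lemma aux_half (p k : ℕ) (hk : 0 < k) (hkp : 2 * k ≤ p) :
    1 / Real.sin ((k : ℝ) * π / p) ^ 2 ≤ (p : ℝ) ^ 2 / 4 * (1 / (k : ℝ) ^ 2) := by
  have hp : (0 : ℝ) < p := by exact_mod_cast (by omega : 0 < p)
  have hk' : (0 : ℝ) < k := by exact_mod_cast hk
  have h2 : 2 * (k : ℝ) ≤ p := by exact_mod_cast hkp
  have hj : 2 / π * ((k : ℝ) * π / p) ≤ Real.sin ((k : ℝ) * π / p) := by
    apply Real.mul_le_sin (by positivity)
    rw [div_le_div_iff₀ hp (by norm_num)]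
    nlinarith [Real.pi_pos]
  have he : 2 / π * ((k : ℝ) * π / p) = 2 * k / p := by
    field_simp
  rw [he] at hj
  have : (p : ℝ) ^ 2 / 4 * (1 / (k : ℝ) ^ 2) = 1 / (2 * k / p) ^ 2 := by
    field_simp
    norm_num
  rw [this]
  gcongr

lemma aux_both (p k : ℕ) (hk : 0 < k) (hkp : k < p) :
    1 / Real.sin ((k : ℝ) * π / p) ^ 2
      ≤ (p : ℝ) ^ 2 / 4 * (1 / (k : ℝ) ^ 2 + 1 / ((p - k : ℕ) : ℝ) ^ 2) := by
  have hp : (0 : ℝ) < p := by exact_mod_cast (by omega : 0 < p)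
  rw [mul_add]
  rcases le_total (2 * k) p with h | h
  · have := aux_half p k hk h
    have : 0 ≤ (p : ℝ) ^ 2 / 4 * (1 / ((p - k : ℕ) : ℝ) ^ 2) := by positivity
    linarith
  · have h1 := aux_half p (p - k) (by omega) (by omega)
    have h2 : Real.sin (((p - k : ℕ) : ℝ) * π / p) = Real.sin ((k : ℝ) * π / p) := by
      rw [← Real.sin_pi_sub, Nat.cast_sub hkp.le]
      congr 1
      field_simp
      ring
    rw [h2] at h1
    have : 0 ≤ (p : ℝ) ^ 2 / 4 * (1 / (k : ℝ) ^ 2) := by positivity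
    linarith

lemma aux_sum_s9 (p : ℕ) :
    ∑ k ∈ Finset.Ico 1 p, 1 / Real.sin ((k : ℝ) * π / p) ^ 2 ≤ (p : ℝ) ^ 2 * (π ^ 2 / 12) := by
  have hz : ∑ k ∈ Finset.Ico 1 p, 1 / (k : ℝ) ^ 2 ≤ π ^ 2 / 6 :=
    sum_le_hasSum _ (fun i _ => by positivity) hasSum_zeta_two
  have hr : ∑ k ∈ Finset.Ico 1 p, 1 / ((p - k : ℕ) : ℝ) ^ 2
      = ∑ k ∈ Finset.Ico 1 p, 1 / (k : ℝ) ^ 2 := by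
    refine Finset.sum_nbij' (fun k => p - k) (fun k => p - k) ?_ ?_ ?_ ?_ ?_
    all_goals intro a ha
    all_goals simp only [Finset.mem_Ico] at *
    all_goals omega
  calc _ ≤ ∑ k ∈ Finset.Ico 1 p,
        (p : ℝ) ^ 2 / 4 * (1 / (k : ℝ) ^ 2 + 1 / ((p - k : ℕ) : ℝ) ^ 2) := by
        apply Finset.sum_le_sum
        intro k hk
        rw [Finset.mem_Ico] at hk
        exact aux_both p k hk.1 hk.2
    _ = (p : ℝ) ^ 2 / 4 * (2 * ∑ k ∈ Finset.Ico 1 p, 1 / (k : ℝ) ^ 2) := by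
        rw [← Finset.mul_sum, Finset.sum_add_distrib, hr, two_mul]
    _ ≤ (p : ℝ) ^ 2 / 4 * (2 * (π ^ 2 / 6)) := by gcongr
    _ = _ := by ring

/-- For coprime `0 < q < p` and `1 ≤ M ≤ p`,
`|(1/p³) Σ_{n=M, n odd}^{p-2} cos(qnπ/p)/(sin²(nπ/2p) sin²(qnπ/p))| ≤ (ζ(2)/2)·p/M²`,
where `ζ(2) = π²/6`. -/
theorem stmt_9 (p q M : ℕ) (h0 : 0 < q) (hqp : q < p) (hco : Nat.Coprime q p)
    (hM1 : 1 ≤ M) (hMp : M ≤ p) :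
    |(1 / (p : ℝ) ^ 3) * ∑ n ∈ (Finset.Icc M (p - 2)).filter (fun n => Odd n),
        Real.cos (q * n * π / p) /
          (Real.sin (n * π / (2 * p)) ^ 2 * Real.sin (q * n * π / p) ^ 2)|
      ≤ (π ^ 2 / 6) / 2 * p / (M : ℝ) ^ 2 := by
  have hp0 : 0 < p := by omega
  have hp : (0 : ℝ) < p := by exact_mod_cast hp0
  have hM : (0 : ℝ) < M := by exact_mod_cast hM1
  set s := (Finset.Icc M (p - 2)).filter (fun n => Odd n) with hs
  have hmem : ∀ n ∈ s, M ≤ n ∧ 1 ≤ n ∧ n < p := by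
    intro n hn
    rw [hs, Finset.mem_filter, Finset.mem_Icc] at hn
    omega
  have hterm : ∀ n ∈ s, |Real.cos (q * n * π / p) /
          (Real.sin (n * π / (2 * p)) ^ 2 * Real.sin (q * n * π / p) ^ 2)|
      ≤ (p : ℝ) ^ 2 / (M : ℝ) ^ 2 * (1 / Real.sin (((q * n % p : ℕ) : ℝ) * π / p) ^ 2) := by
    intro n hn
    obtain ⟨h1, h2, h3⟩ := hmem n hn
    rw [aux_sin_mod p (q * n) hp0]
    have h := aux_half (2 * p) n h2 (by omega)
    push_cast at h ⊢
    have hMn : (M : ℝ) ≤ n := by exact_mod_cast h1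
    have hle : 1 / Real.sin ((n : ℝ) * π / (2 * p)) ^ 2 ≤ (p : ℝ) ^ 2 / (M : ℝ) ^ 2 := by
      calc _ ≤ _ := h
        _ = (p : ℝ) ^ 2 / (n : ℝ) ^ 2 := by ring
        _ ≤ _ := by gcongr
    rw [abs_div, abs_of_nonneg (by positivity : 0 ≤ Real.sin (n * π / (2 * p)) ^ 2 * Real.sin (q * n * π / p) ^ 2)]
    calc _ ≤ 1 / (Real.sin (n * π / (2 * p)) ^ 2 * Real.sin (q * n * π / p) ^ 2) := by
          gcongr
          exact Real.abs_cos_le_one _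
      _ = 1 / Real.sin (n * π / (2 * p)) ^ 2 * (1 / Real.sin (q * n * π / p) ^ 2) := by
          rw [one_div_mul_one_div]
      _ ≤ _ := by gcongr
  have hinj : Set.InjOn (fun n => q * n % p) (s : Set ℕ) := by
    intro a ha b hb hab
    have h1 := hmem a ha
    have h2 := hmem b hb
    have h3 : q * a ≡ q * b [MOD p] := hab
    have h4 : a ≡ b [MOD p] := Nat.ModEq.cancel_left_of_coprime hco.symm h3
    exact Nat.ModEq.eq_of_lt_of_lt h4 h1.2.2 h2.2.2
  have himg : s.image (fun n => q * n % p) ⊆ Finset.Ico 1 p := by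
    intro m hm
    obtain ⟨n, hn, rfl⟩ := Finset.mem_image.1 hm
    obtain ⟨_, h2, h3⟩ := hmem n hn
    rw [Finset.mem_Ico]
    refine ⟨?_, Nat.mod_lt _ hp0⟩
    by_contra hc
    have hd : p ∣ q * n := Nat.dvd_of_mod_eq_zero (by omega)
    have := Nat.le_of_dvd h2 (hco.symm.dvd_of_dvd_mul_left hd)
    omega
  have hsum : ∑ n ∈ s, 1 / Real.sin (((q * n % p : ℕ) : ℝ) * π / p) ^ 2
      ≤ (p : ℝ) ^ 2 * (π ^ 2 / 12) := by
    refine le_trans ?_ (aux_sum_s9 p)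
    rw [← Finset.sum_image (f := fun k : ℕ => 1 / Real.sin ((k : ℝ) * π / p) ^ 2) hinj]
    exact Finset.sum_le_sum_of_subset_of_nonneg himg (fun i _ _ => by positivity)
  rw [abs_mul, abs_of_nonneg (by positivity : 0 ≤ 1 / (p : ℝ) ^ 3)]
  calc _ ≤ 1 / (p : ℝ) ^ 3 * ((p : ℝ) ^ 2 / (M : ℝ) ^ 2 * ((p : ℝ) ^ 2 * (π ^ 2 / 12))) := by
        gcongr
        refine (Finset.abs_sum_le_sum_abs _ _).trans ((Finset.sum_le_sum hterm).trans ?_)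
        rw [← Finset.mul_sum]
        gcongr
    _ = _ := by
        field_simp
        norm_num
end

section
/- Let p, q be coprime positive integers, and let P, P', a be positive integers with P ≤ P', P' ≤ (a+1)·P, and P' ≤ p. Assume that for all integers n, ℓ with 1 ≤ n < P' one has |n·(q/p) - ℓ| ≥ 1/(P + P'). Then for every integer n with P ≤ n < P', one has sin²(πn/(2p)) · sin²(qnπ/p) ≥ 4 / ( p² (a+2)² ). -/
open Real

/-- Zaremba-type lower bound, Lemma 4.7. Let `p, q` be coprime
positive integers and `P ≤ P'`, `P' ≤ (a+1)P`, `P' ≤ p` positive integers such that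
`|n(q/p) - ℓ| ≥ 1/(P+P')` for all integers `1 ≤ n < P'` and all `ℓ ∈ ℤ`. Then for every
`P ≤ n < P'` one has `sin²(πn/(2p)) sin²(qnπ/p) ≥ 4/(p²(a+2)²)`. -/
theorem stmt_10 (p q P P' a : ℕ) (hp : 0 < p) (hq : 0 < q) (hco : Nat.Coprime q p)
    (hP : 0 < P) (hP' : 0 < P') (ha : 0 < a)
    (hPP' : P ≤ P') (hP'a : P' ≤ (a + 1) * P) (hP'p : P' ≤ p)
    (hbest : ∀ n : ℕ, 1 ≤ n → n < P' → ∀ ℓ : ℤ,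
      (1 : ℝ) / ((P : ℝ) + (P' : ℝ)) ≤ |(n : ℝ) * ((q : ℝ) / (p : ℝ)) - (ℓ : ℝ)|) :
    ∀ n : ℕ, P ≤ n → n < P' →
      Real.sin (π * n / (2 * p)) ^ 2 * Real.sin (q * n * π / p) ^ 2
        ≥ 4 / ((p : ℝ) ^ 2 * ((a : ℝ) + 2) ^ 2) := by
  intro n hn hn'
  have hpR : (0 : ℝ) < p := by exact_mod_cast hp
  have hPR : (0 : ℝ) < P := by exact_mod_cast hP
  have hP'R : (0 : ℝ) < P' := by exact_mod_cast hP'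
  have hnR : (P : ℝ) ≤ n := by exact_mod_cast hn
  have hnp : (n : ℝ) ≤ p := by exact_mod_cast (hn'.le.trans hP'p)
  have haR : (P' : ℝ) ≤ (a + 1) * P := by exact_mod_cast hP'a
  have h1 : (n : ℝ) / p ≤ Real.sin (π * n / (2 * p)) := by
    have h := Real.le_sin_mul (x := (n : ℝ) / p) (by positivity) ((div_le_one hpR).2 hnp)
    have e : π * n / (2 * p) = π / 2 * ((n : ℝ) / p) := by ring
    rwa [e]
  obtain ⟨x, hx⟩ : ∃ x : ℝ, x = (n : ℝ) * ((q : ℝ) / p) := ⟨_, rfl⟩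
  have hb := hbest n (by omega) hn' (round x)
  rw [← hx] at hb
  have hr := abs_sub_round x
  have h2 : 2 * |x - round x| ≤ |Real.sin (q * n * π / p)| := by
    have h := Real.le_sin_mul (x := 2 * |x - round x|) (by positivity) (by linarith)
    have e : (q : ℝ) * n * π / p = x * π := by rw [hx]; ring
    have e2 : π / 2 * (2 * |x - round x|) = |x * π - round x * π| := by
      rw [← sub_mul, abs_mul, abs_of_pos Real.pi_pos]; ring
    have e3 : |Real.sin (|x * π - round x * π|)| = |Real.sin (x * π)| := by
      have e4 : |Real.sin (|x * π - round x * π|)| = |Real.sin (x * π - round x * π)| := by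
        rcases abs_choice (x * π - round x * π) with h | h <;> rw [h]
        rw [Real.sin_neg, abs_neg]
      rw [e4, Real.sin_sub_int_mul_pi, abs_mul]
      simp
    rw [e, ← e3, ← e2]
    exact h.trans (le_abs_self _)
  have h3 : 2 / ((a + 2) * (P : ℝ)) ≤ |Real.sin (q * n * π / p)| := by
    refine le_trans ?_ h2
    have : 1 / ((a + 2) * (P : ℝ)) ≤ 1 / ((P : ℝ) + P') :=
      one_div_le_one_div_of_le (by positivity) (by linarith)
    have e : 2 / ((a + 2) * (P : ℝ)) = 2 * (1 / ((a + 2) * (P : ℝ))) := by ring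
    linarith
  have h4 : (P : ℝ) / p ≤ Real.sin (π * n / (2 * p)) :=
    le_trans (by gcongr) h1
  rw [← sq_abs (Real.sin (q * n * π / p))]
  calc 4 / ((p : ℝ) ^ 2 * ((a : ℝ) + 2) ^ 2)
      = ((P : ℝ) / p) ^ 2 * (2 / ((a + 2) * (P : ℝ))) ^ 2 := by field_simp; norm_num
    _ ≤ _ := by gcongr
end

section
/- Let (a_k)_{k ≥ 1} be a sequence of positive integers and define integer sequences by q_{-1} = 1, q_0 = 0, p_{-1} = 0, p_0 = 1, and q_k = a_k q_{k-1} + q_{k-2}, p_k = a_k p_{k-1} + p_{k-2} for k ≥ 1. Let θ ∈ (0,1) be the limit of q_k/p_k. Assume: (i) θ is diophantine; (ii) there exists K such that a_k < k² for all k ≥ K; (iii) p_k^{1/k} converges to some L > 1. Define σ̃₂(q,p) := (1-p²)/(6p²) + (1/(4p²)) · Σ_{n=1, n odd}^{p-2} f(n,p,q) / ( sin³(nπ/(2p)) · sin²(qnπ/p) ). Then lim_{k→∞} σ̃₂(q_k, p_k) / p_k² = (16/π³) · Σ_{n ≥ 1, n odd} 1/(n³ sin(nπθ)). -/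
open Real Finset Filter

/-- The trigonometric expression `σ̃₂(q,p)` computing the genus-2 signature. -/
noncomputable def sigma2tilde (q p : ℕ) : ℝ :=
  (1 - (p : ℝ) ^ 2) / (6 * (p : ℝ) ^ 2) +
    (1 / (4 * (p : ℝ) ^ 2)) *
      ∑ n ∈ (Finset.Icc 1 (p - 2)).filter (fun n => Odd n),
        fnpq n p q / (Real.sin (n * π / (2 * p)) ^ 3 * Real.sin (q * n * π / p) ^ 2)

/-- The algebraic simplification of `fnpq`. -/
lemma fnpq_eq (n p q : ℕ) (hp : 0 < p) :
    fnpq n p q = 8 * p * Real.sin (q * n * π / p) * Real.cos (n * π / (2 * p)) ^ 3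
      + 8 * Real.cos (q * n * π / p) * Real.sin (n * π / (2 * p)) ^ 3 := by
  have hp' : (p : ℝ) ≠ 0 := by positivity
  unfold fnpq
  set x : ℝ := n * π / (2 * p) with hx
  set y : ℝ := q * n * π / p with hy
  have e1 : (2 * (q : ℝ) - 1) * n * π / (2 * p) = y - x := by rw [hx, hy]; field_simp
  have e2 : (2 * (q : ℝ) - 3) * n * π / (2 * p) = y - 3 * x := by rw [hx, hy]; field_simp
  have e3 : (2 * (q : ℝ) + 3) * n * π / (2 * p) = y + 3 * x := by rw [hx, hy]; field_simp
  have e4 : (2 * (q : ℝ) + 1) * n * π / (2 * p) = y + x := by rw [hx, hy]; field_simp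
  rw [e1, e2, e3, e4, Real.sin_sub, Real.sin_sub, Real.sin_add, Real.sin_add,
    Real.cos_three_mul, Real.sin_three_mul]
  ring

lemma abs_sin_pi_mul_ge (t c : ℝ) (h : ∀ l : ℤ, c ≤ |t - l|) : 2 * c ≤ |Real.sin (t * π)| := by
  have h1 := h (round t)
  have h2 : |t - round t| ≤ 1 / 2 := abs_sub_round t
  have h3 : |Real.sin (t * π)| = |Real.sin ((t - round t) * π)| := by
    rw [sub_mul, Real.sin_sub_int_mul_pi, abs_mul]
    simp
  rw [h3]
  have h4 : |(t - round t) * π| ≤ π / 2 := by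
    rw [abs_mul, abs_of_pos Real.pi_pos]
    nlinarith [Real.pi_pos]
  have h5 := Real.mul_abs_le_abs_sin h4
  rw [abs_mul, abs_of_pos Real.pi_pos] at h5
  have h6 : 2 / π * (|t - round t| * π) = 2 * |t - round t| := by
    field_simp
  linarith

lemma one_div_le_abs (n p q : ℕ) (hn : 1 ≤ n) (hnp : n < p) (hc : Nat.Coprime p q) (l : ℤ) :
    1 / (p : ℝ) ≤ |(n : ℝ) * q / p - l| := by
  have hp : (0 : ℝ) < p := by exact_mod_cast (by omega : 0 < p)
  have e : (n : ℝ) * q / p - l = (((n * q - p * l : ℤ)) : ℝ) / p := by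
    push_cast; field_simp
  rw [e, abs_div, abs_of_pos hp]
  gcongr
  have : (n * q - p * l : ℤ) ≠ 0 := by
    intro h0
    have h1 : (p : ℤ) ∣ n * q := ⟨l, by linarith⟩
    have h2 : p ∣ n * q := by exact_mod_cast h1
    have h3 : p ∣ n := hc.dvd_of_dvd_mul_right h2
    have := Nat.le_of_dvd (by omega) h3
    omega
  have h2 := Int.one_le_abs this
  exact_mod_cast h2

lemma le_of_sq_le_sq_aux {x y : ℝ} (h : x ^ 2 ≤ y ^ 2) (hy : 0 ≤ y) : x ≤ y :=
  abs_le_of_sq_le_sq' h hy |>.2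

lemma uniform_bound (θ : ℝ) (hdio : Diophantine θ) :
    ∃ c : ℝ, 0 < c ∧ ∀ n p q : ℕ, 1 ≤ n → n < p → Nat.Coprime p q →
      |θ - (q : ℝ) / p| ≤ 1 / (p : ℝ) ^ 2 → ∀ l : ℤ,
      c * (n : ℝ) ^ (-(3 / 2) : ℝ) ≤ |(n : ℝ) * q / p - l| := by
  obtain ⟨C, hC, h⟩ := hdio (1 / 2) (by norm_num)
  refine ⟨min (C / 2) (Real.sqrt (C / 2)), by positivity, ?_⟩
  intro n p q hn hnp hc hθ l
  have hp : (0 : ℝ) < p := by exact_mod_cast (by omega : 0 < p)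
  have hn1 : (1 : ℝ) ≤ n := by exact_mod_cast hn
  have hn0 : (0 : ℝ) < n := by linarith
  set r : ℝ := (n : ℝ) ^ (-(3 / 2) : ℝ) with hr
  have hr0 : 0 < r := by positivity
  have hr2 : r ^ 2 * (n : ℝ) ^ 3 = 1 := by
    rw [hr, ← Real.rpow_natCast, ← Real.rpow_mul hn0.le, ← Real.rpow_natCast,
      ← Real.rpow_add hn0]
    norm_num
  by_cases hcase : (n : ℝ) / (p : ℝ) ^ 2 ≤ C / 2 * r
  · have h1 := h n hn l
    have e : (-1 - 1 / 2 : ℝ) = -(3 / 2) := by norm_num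
    rw [e, ← hr] at h1
    have h2 : |(n : ℝ) * θ - l| ≤ |(n : ℝ) * q / p - l| + (n : ℝ) / (p : ℝ) ^ 2 := by
      have e2 : (n : ℝ) * θ - l = ((n : ℝ) * q / p - l) + n * (θ - q / p) := by ring
      rw [e2]
      refine (abs_add_le _ _).trans ?_
      rw [abs_mul, abs_of_pos hn0]
      have : (n : ℝ) / (p : ℝ) ^ 2 = n * (1 / (p : ℝ) ^ 2) := by ring
      rw [this]
      gcongr
    have h3 : min (C / 2) (Real.sqrt (C / 2)) * r ≤ C / 2 * r := by
      gcongr; exact min_le_left _ _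
    linarith
  · push Not at hcase
    refine le_trans ?_ (one_div_le_abs n p q hn hnp hc l)
    have h3 : min (C / 2) (Real.sqrt (C / 2)) * r ≤ Real.sqrt (C / 2) * r := by
      gcongr; exact min_le_right _ _
    refine h3.trans ?_
    refine le_of_sq_le_sq_aux ?_ (by positivity)
    rw [mul_pow, Real.sq_sqrt (by positivity), div_pow, one_pow]
    have h4 : C / 2 * r * (p : ℝ) ^ 2 < n := by
      rwa [lt_div_iff₀ (by positivity)] at hcase
    have h5 : n * r ≤ 1 := by
      refine le_of_sq_le_sq_aux ?_ (by norm_num)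
      rw [one_pow, mul_pow, ← hr2]
      have : (n : ℝ) ^ 2 ≤ (n : ℝ) ^ 3 := by gcongr <;> norm_num
      nlinarith [sq_nonneg r]
    rw [le_div_iff₀ (by positivity)]
    nlinarith

lemma cos_div_sinc_mem (x : ℝ) (h0 : 0 < x) (h1 : x < π / 2) :
    0 ≤ Real.cos x / Real.sinc x ∧ Real.cos x / Real.sinc x ≤ 1 := by
  have hs : 0 < Real.sin x := Real.sin_pos_of_pos_of_lt_pi h0 (by linarith)
  have hc : 0 < Real.cos x := Real.cos_pos_of_mem_Ioo ⟨by linarith, h1⟩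
  have ht := Real.lt_tan h0 h1
  rw [Real.tan_eq_sin_div_cos, lt_div_iff₀ hc] at ht
  rw [Real.sinc_of_ne_zero h0.ne']
  constructor
  · positivity
  · rw [div_le_one (by positivity), le_div_iff₀ h0]
    linarith

/-- The main term. -/
noncomputable def mainTerm (p q n : ℕ) : ℝ :=
  if Odd n ∧ n ≤ p - 2 then
    16 / (π ^ 3 * n ^ 3) * (Real.cos (n * π / (2 * p)) / Real.sinc (n * π / (2 * p))) ^ 3
      / Real.sin (q * n * π / p) else 0

lemma sigma_eq (p q : ℕ) (hp : 2 < p) (hc : Nat.Coprime p q) :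
    |sigma2tilde q p / (p : ℝ) ^ 2 - ∑' n, mainTerm p q n| ≤ 1 / p := by
  have hp0 : (0 : ℝ) < p := by exact_mod_cast (by omega : 0 < p)
  have hp3 : (3 : ℝ) ≤ p := by exact_mod_cast hp
  set S := (Finset.Icc 1 (p - 2)).filter (fun n => Odd n) with hS
  have hmem : ∀ n, n ∈ S ↔ (Odd n ∧ n ≤ p - 2) := by
    intro n
    simp only [hS, Finset.mem_filter, Finset.mem_Icc]
    constructor
    · tauto
    · rintro ⟨h1, h2⟩
      exact ⟨⟨h1.pos, h2⟩, h1⟩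
  have htsum : ∑' n, mainTerm p q n = ∑ n ∈ S, mainTerm p q n := by
    apply tsum_eq_sum
    intro n hn
    rw [hmem] at hn
    simp [mainTerm, hn]
  have hsin : ∀ n ∈ S, 2 / (p : ℝ) ≤ |Real.sin (q * n * π / p)| := by
    intro n hn
    rw [hmem] at hn
    have := abs_sin_pi_mul_ge ((n : ℝ) * q / p) (1 / p)
      (one_div_le_abs n p q hn.1.pos (by omega) hc)
    have e : (n : ℝ) * q / p * π = q * n * π / p := by ring
    rw [e] at this
    calc 2 / (p : ℝ) = 2 * (1 / p) := by ring
      _ ≤ _ := this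
  have hterm : ∀ n ∈ S,
      fnpq n p q / (Real.sin (n * π / (2 * p)) ^ 3 * Real.sin (q * n * π / p) ^ 2)
      = 4 * (p : ℝ) ^ 4 * mainTerm p q n
        + 8 * (Real.cos (q * n * π / p) / Real.sin (q * n * π / p) ^ 2) := by
    intro n hn
    have hy : Real.sin (q * n * π / p) ≠ 0 := by
      intro h0
      have := hsin n hn
      rw [h0, abs_zero] at this
      have : 0 < 2 / (p : ℝ) := by positivity
      linarith
    rw [hmem] at hn
    have hn0 : (0 : ℝ) < n := by exact_mod_cast hn.1.pos
    have hnp : (n : ℝ) < p := by exact_mod_cast (by omega : n < p)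
    have hx0 : 0 < n * π / (2 * (p : ℝ)) := by positivity
    have hx1 : n * π / (2 * (p : ℝ)) < π := by
      rw [div_lt_iff₀ (by positivity)]
      nlinarith [Real.pi_pos]
    have hx : 0 < Real.sin (n * π / (2 * p)) := Real.sin_pos_of_pos_of_lt_pi hx0 hx1
    rw [mainTerm, if_pos hn, fnpq_eq n p q (by omega), Real.sinc_of_ne_zero hx0.ne']
    generalize Real.sin (q * n * π / p) = s at *
    generalize Real.cos (q * n * π / p) = c at *
    generalize Real.cos (n * π / (2 * p)) = d at *
    generalize Real.sin (n * π / (2 * p)) = e at *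
    have hpi := Real.pi_pos
    field_simp
    ring
  have hmain : sigma2tilde q p / (p : ℝ) ^ 2 - ∑' n, mainTerm p q n
      = (1 - (p : ℝ) ^ 2) / (6 * (p : ℝ) ^ 4)
        + 2 / (p : ℝ) ^ 4 * ∑ n ∈ S, Real.cos (q * n * π / p) / Real.sin (q * n * π / p) ^ 2 := by
    rw [htsum, sigma2tilde, ← hS, Finset.sum_congr rfl hterm, Finset.sum_add_distrib,
      ← Finset.mul_sum, ← Finset.mul_sum]
    generalize ∑ n ∈ S, Real.cos (q * n * π / p) / Real.sin (q * n * π / p) ^ 2 = A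
    generalize ∑ n ∈ S, mainTerm p q n = B
    field_simp
    ring
  have hsum : |∑ n ∈ S, Real.cos (q * n * π / p) / Real.sin (q * n * π / p) ^ 2|
      ≤ p * ((p : ℝ) ^ 2 / 4) := by
    refine (Finset.abs_sum_le_sum_abs _ _).trans ?_
    have hcard : (S.card : ℝ) ≤ p := by
      have : S.card ≤ (Finset.Icc 1 (p - 2)).card := Finset.card_filter_le _ _
      rw [Nat.card_Icc] at this
      exact_mod_cast (by omega : S.card ≤ p)
    calc _ ≤ S.card • ((p : ℝ) ^ 2 / 4) := by
          apply Finset.sum_le_card_nsmul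
          intro n hn
          have h := hsin n hn
          have h2 : (2 / (p : ℝ)) ^ 2 ≤ Real.sin (q * n * π / p) ^ 2 := by
            rw [← sq_abs (Real.sin _)]
            gcongr
          have h3 : 0 < (2 / (p : ℝ)) ^ 2 := by positivity
          rw [abs_div, abs_of_nonneg (sq_nonneg (Real.sin (q * n * π / p)))]
          calc _ ≤ 1 / (2 / (p : ℝ)) ^ 2 := by
                gcongr
                exact Real.abs_cos_le_one _
            _ = _ := by field_simp; norm_num
      _ ≤ _ := by
          rw [nsmul_eq_mul]; gcongr
  rw [hmain]
  refine (abs_add_le _ _).trans ?_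
  rw [abs_mul, abs_of_pos (by positivity : 0 < 2 / (p : ℝ) ^ 4), abs_div,
    abs_of_pos (by positivity : 0 < 6 * (p : ℝ) ^ 4), abs_of_nonpos (by nlinarith)]
  have a1 : -(1 - (p : ℝ) ^ 2) / (6 * (p : ℝ) ^ 4) ≤ 1 / (2 * p) := by
    rw [div_le_div_iff₀ (by positivity) (by positivity)]
    have : (p : ℝ) ^ 3 * 3 ≤ (p : ℝ) ^ 3 * p := by gcongr
    nlinarith [pow_pos hp0 3]
  have a2 : 2 / (p : ℝ) ^ 4 * |∑ n ∈ S, Real.cos (q * n * π / p) / Real.sin (q * n * π / p) ^ 2|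
      ≤ 1 / (2 * p) := by
    calc _ ≤ 2 / (p : ℝ) ^ 4 * (p * ((p : ℝ) ^ 2 / 4)) := by gcongr
      _ = _ := by field_simp; norm_num
  have a3 : 1 / (p : ℝ) = 1 / (2 * p) + 1 / (2 * p) := by field_simp; norm_num
  linarith

lemma main_tendsto (p q : ℕ → ℕ) (θ : ℝ) (hp : ∀ k, k ≤ p k)
    (hc : ∀ k, Nat.Coprime (p k) (q k))
    (happ : ∀ k, |θ - (q k : ℝ) / p k| ≤ 1 / (p k : ℝ) ^ 2)
    (hlim : Tendsto (fun k => (q k : ℝ) / (p k : ℝ)) atTop (nhds θ))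
    (hdio : Diophantine θ) :
    Tendsto (fun k => sigma2tilde (q k) (p k) / (p k : ℝ) ^ 2) atTop
      (nhds ((16 / π ^ 3) *
        ∑' n : ℕ, if Odd n then 1 / ((n : ℝ) ^ 3 * Real.sin (n * π * θ)) else 0)) := by
  have hptop : Tendsto p atTop atTop := tendsto_atTop_mono hp tendsto_id
  have hptop' : Tendsto (fun k => (p k : ℝ)) atTop atTop :=
    tendsto_natCast_atTop_atTop.comp hptop
  have hinv : Tendsto (fun k => 1 / (p k : ℝ)) atTop (nhds 0) := by
    simp only [one_div]
    exact hptop'.inv_tendsto_atTop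
  have hdiff : Tendsto (fun k => sigma2tilde (q k) (p k) / (p k : ℝ) ^ 2
      - ∑' n, mainTerm (p k) (q k) n) atTop (nhds 0) := by
    apply squeeze_zero_norm' _ hinv
    filter_upwards [hptop.eventually_gt_atTop 2] with k hk
    exact sigma_eq (p k) (q k) hk (hc k)
  suffices hT : Tendsto (fun k => ∑' n, mainTerm (p k) (q k) n) atTop
      (nhds ((16 / π ^ 3) *
        ∑' n : ℕ, if Odd n then 1 / ((n : ℝ) ^ 3 * Real.sin (n * π * θ)) else 0)) by
    simpa using hdiff.add hT
  rw [← tsum_mul_left]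
  obtain ⟨c, hc0, hcb⟩ := uniform_bound θ hdio
  have hpi := Real.pi_pos
  apply tendsto_tsum_of_dominated_convergence
    (bound := fun n : ℕ => 16 / (π ^ 3 * (2 * c)) * (n : ℝ) ^ (-(3 / 2) : ℝ))
  · apply Summable.mul_left
    apply Real.summable_nat_rpow.2
    norm_num
  · intro n
    by_cases hodd : Odd n
    · have hn0 : (0 : ℝ) < n := by exact_mod_cast hodd.pos
      rw [if_pos hodd]
      have hs0 : Real.sin (n * π * θ) ≠ 0 := by
        obtain ⟨C, hC, h⟩ := hdio 1 one_pos
        have := abs_sin_pi_mul_ge (n * θ) _ (h n hodd.pos)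
        intro h0
        have e : (n : ℝ) * θ * π = n * π * θ := by ring
        rw [e, h0, abs_zero] at this
        have : 0 < 2 * (C * (n : ℝ) ^ (-1 - 1 : ℝ)) := by positivity
        linarith
      have hx : Tendsto (fun k => (n : ℝ) * π / (2 * p k)) atTop (nhds 0) := by
        have := hinv.const_mul ((n : ℝ) * π / 2)
        rw [mul_zero] at this
        refine this.congr fun k => ?_
        ring
      have hy : Tendsto (fun k => (q k : ℝ) * n * π / p k) atTop (nhds (n * π * θ)) := by
        refine (hlim.const_mul ((n : ℝ) * π)).congr fun k => ?_
        ring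
      have h1 : Tendsto (fun k => Real.cos ((n : ℝ) * π / (2 * p k))) atTop (nhds 1) := by
        simpa [Function.comp_def] using (Real.continuous_cos.tendsto 0).comp hx
      have h2 : Tendsto (fun k => Real.sinc ((n : ℝ) * π / (2 * p k))) atTop (nhds 1) := by
        simpa [Function.comp_def] using (Real.continuous_sinc.tendsto 0).comp hx
      have h3 : Tendsto (fun k => Real.sin ((q k : ℝ) * n * π / p k)) atTop
          (nhds (Real.sin (n * π * θ))) := (Real.continuous_sin.tendsto _).comp hy
      have h4 := ((((h1.div h2 one_ne_zero).pow 3).const_mul (16 / (π ^ 3 * (n : ℝ) ^ 3))).div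
        h3 hs0)
      have e : 16 / (π ^ 3 * (n : ℝ) ^ 3) * (1 / 1) ^ 3 / Real.sin (n * π * θ)
          = 16 / π ^ 3 * (1 / ((n : ℝ) ^ 3 * Real.sin (n * π * θ))) := by
        field_simp
      rw [e] at h4
      refine h4.congr' ?_
      filter_upwards [hptop.eventually_ge_atTop (n + 2)] with k hk
      have : Odd n ∧ n ≤ p k - 2 := ⟨hodd, by omega⟩
      simp [mainTerm, this]
    · simp [mainTerm, hodd]
  · refine Eventually.of_forall fun k n => ?_
    by_cases hn : Odd n ∧ n ≤ p k - 2
    · rw [mainTerm, if_pos hn]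
      have hnpos : 0 < n := hn.1.pos
      have hn0 : (0 : ℝ) < n := by exact_mod_cast hnpos
      have hnp : (n : ℝ) < p k := by exact_mod_cast (by omega : n < p k)
      have hp0 : (0 : ℝ) < p k := by linarith
      have hs := abs_sin_pi_mul_ge _ _ (hcb n (p k) (q k) hnpos (by omega) (hc k) (happ k))
      have e : (n : ℝ) * q k / p k * π = q k * n * π / p k := by ring
      rw [e] at hs
      have hx0 : 0 < n * π / (2 * (p k : ℝ)) := by positivity
      have hx1 : n * π / (2 * (p k : ℝ)) < π / 2 := by
        rw [div_lt_div_iff₀ (by positivity) (by positivity)]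
        nlinarith
      obtain ⟨b0, b1⟩ := cos_div_sinc_mem _ hx0 hx1
      set r : ℝ := (n : ℝ) ^ (-(3 / 2) : ℝ) with hr
      have hr0 : 0 < r := by positivity
      have hr2 : r ^ 2 * (n : ℝ) ^ 3 = 1 := by
        rw [hr, ← Real.rpow_natCast, ← Real.rpow_mul hn0.le, ← Real.rpow_natCast,
          ← Real.rpow_add hn0]
        norm_num
      rw [Real.norm_eq_abs, abs_div, abs_of_nonneg (by positivity)]
      calc _ ≤ 16 / (π ^ 3 * n ^ 3) * 1 ^ 3 / (2 * (c * r)) := by gcongr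
        _ = _ := by
          have : (n : ℝ) ^ 3 = 1 / r ^ 2 := by field_simp; linarith
          rw [this]
          field_simp
    · rw [mainTerm, if_neg hn, norm_zero]
      positivity

/-- Theorem 4.1. Along the convergents `q_k/p_k` of a typical
irrational `θ ∈ (0,1)`, one has
`σ̃₂(q_k,p_k)/p_k² → (16/π³) Σ_{n ≥ 1 odd} 1/(n³ sin(nπθ))`. -/
theorem stmt_11 (a q p : ℕ → ℕ) (ha : ∀ k, 1 ≤ k → 0 < a k)
    (hq0 : q 0 = 0) (hq1 : q 1 = 1) (hp0 : p 0 = 1) (hp1 : p 1 = a 1)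
    (hqrec : ∀ k, 2 ≤ k → q k = a k * q (k - 1) + q (k - 2))
    (hprec : ∀ k, 2 ≤ k → p k = a k * p (k - 1) + p (k - 2))
    (θ : ℝ) (hθ : θ ∈ Set.Ioo (0 : ℝ) 1)
    (hlim : Tendsto (fun k => (q k : ℝ) / (p k : ℝ)) atTop (nhds θ))
    (hdio : Diophantine θ)
    (hgrow : ∃ K : ℕ, ∀ k, K ≤ k → a k < k ^ 2)
    (hlevy : ∃ L : ℝ, 1 < L ∧
      Tendsto (fun k : ℕ => (p k : ℝ) ^ ((1 : ℝ) / (k : ℝ))) atTop (nhds L)) :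
    Tendsto (fun k => sigma2tilde (q k) (p k) / (p k : ℝ) ^ 2) atTop
      (nhds ((16 / π ^ 3) *
        ∑' n : ℕ, if Odd n then 1 / ((n : ℝ) ^ 3 * Real.sin (n * π * θ)) else 0)) := by
  have hstep : ∀ k, q (k + 2) = a (k + 2) * q (k + 1) + q k ∧
      p (k + 2) = a (k + 2) * p (k + 1) + p k := fun k =>
    ⟨hqrec (k + 2) (by omega), hprec (k + 2) (by omega)⟩
  have hmono1 : ∀ k, 1 ≤ p k ∧ p k ≤ p (k + 1) ∧ k + 1 ≤ p (k + 1) := by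
    intro k
    induction k with
    | zero =>
      have := ha 1 le_rfl
      rw [hp0, hp1]
      omega
    | succ k ih =>
      have h1 := (hstep k).2
      have h2 := ha (k + 2) (by omega)
      have h3 : p (k + 1) ≤ a (k + 2) * p (k + 1) := Nat.le_mul_of_pos_left _ h2
      have : p (k + 1 + 1) = p (k + 2) := rfl
      omega
  have hp : ∀ k, k ≤ p k := by
    intro k
    cases k with
    | zero => omega
    | succ k => exact (hmono1 k).2.2
  have hdet : ∀ k, ((q (k + 1) : ℤ) * p k - p (k + 1) * q k) = (-1) ^ k := by
    intro k
    induction k with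
    | zero => simp [hq0, hq1, hp0]
    | succ k ih =>
      have h1 := (hstep k).2
      have h2 := (hstep k).1
      have e : k + 1 + 1 = k + 2 := rfl
      rw [e, h1, h2, pow_succ, ← ih]
      push_cast
      ring
  have hc : ∀ k, Nat.Coprime (p k) (q k) := by
    intro k
    rw [← Nat.isCoprime_iff_coprime]
    have hsq : ((-1 : ℤ) ^ k) * (-1) ^ k = 1 := by
      rw [← mul_pow]; norm_num
    refine ⟨(-1) ^ k * q (k + 1), -(-1) ^ k * p (k + 1), ?_⟩
    linear_combination hsq + (-1) ^ k * hdet k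
  have hD : ∀ k m, |(q (k + m) : ℤ) * p k - p (k + m) * q k| * p k ≤ p (k + m) ∧
      |(q (k + m + 1) : ℤ) * p k - p (k + m + 1) * q k| * p k ≤ p (k + m + 1) := by
    intro k m
    induction m with
    | zero =>
      constructor
      · have : (q (k + 0) : ℤ) * p k - p (k + 0) * q k = 0 := by simp; ring
        rw [this]; simp
      · have := hdet k
        rw [add_zero, this, abs_pow, abs_neg, abs_one, one_pow, one_mul]
        exact_mod_cast (hmono1 k).2.1
    | succ m ih =>
      refine ⟨ih.2, ?_⟩
      obtain ⟨h2, h1⟩ := hstep (k + m)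
      have e : k + (m + 1) + 1 = k + m + 2 := rfl
      rw [e, h1, h2]
      push_cast
      have e2 : ((a (k + m + 2) : ℤ) * q (k + m + 1) + q (k + m)) * p k
          - (a (k + m + 2) * p (k + m + 1) + p (k + m)) * q k
          = a (k + m + 2) * ((q (k + m + 1) : ℤ) * p k - p (k + m + 1) * q k)
            + ((q (k + m) : ℤ) * p k - p (k + m) * q k) := by ring
      rw [e2]
      have h3 := abs_add_le (a (k + m + 2) * ((q (k + m + 1) : ℤ) * p k - p (k + m + 1) * q k))
        ((q (k + m) : ℤ) * p k - p (k + m) * q k)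
      rw [abs_mul, Nat.abs_cast] at h3
      calc _ ≤ ((a (k + m + 2) : ℤ) * |(q (k + m + 1) : ℤ) * p k - p (k + m + 1) * q k|
            + |(q (k + m) : ℤ) * p k - p (k + m) * q k|) * p k := by gcongr
        _ = a (k + m + 2) * (|(q (k + m + 1) : ℤ) * p k - p (k + m + 1) * q k| * p k)
            + |(q (k + m) : ℤ) * p k - p (k + m) * q k| * p k := by ring
        _ ≤ _ := by
          gcongr
          · exact ih.2
          · exact ih.1
  have happ : ∀ k, |θ - (q k : ℝ) / p k| ≤ 1 / (p k : ℝ) ^ 2 := by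
    intro k
    refine le_of_tendsto ((hlim.sub_const ((q k : ℝ) / p k)).abs) ?_
    filter_upwards [eventually_ge_atTop k] with j hj
    obtain ⟨m, rfl⟩ := Nat.exists_eq_add_of_le hj
    have h := (hD k m).1
    have h' : |(q (k + m) : ℝ) * p k - p (k + m) * q k| * p k ≤ p (k + m) := by exact_mod_cast h
    have hk0 : (0 : ℝ) < p k := by exact_mod_cast (hmono1 k).1
    have hm0 : (0 : ℝ) < p (k + m) := by exact_mod_cast (hmono1 (k + m)).1
    rw [div_sub_div _ _ hm0.ne' hk0.ne', abs_div, abs_of_pos (mul_pos hm0 hk0),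
      div_le_div_iff₀ (by positivity) (by positivity)]
    nlinarith
  exact main_tendsto p q θ hp hc happ hlim hdio
end

section
/- Let q, p be coprime integers with p > 0 and q odd. Then S(q/p) = (1/(2p)) · Σ_{k=1, k odd}^{2p-1} cot(πk/(2p)) · cot(πkq/(2p)), where the sum runs over the odd integers k with 1 ≤ k ≤ 2p-1. -/
open Real Finset

/-- `S(q/p) = (1/2) Σ_{n=1}^{p-1} (-1)^{⌊nq/p⌋}` for coprime `q, p` with `p > 0`, `q` odd. -/
noncomputable def Sfun (q p : ℤ) : ℝ :=
  (1 / 2) * ∑ n ∈ Finset.Icc (1 : ℤ) (p - 1), (-1 : ℝ) ^ ⌊((n * q : ℤ) : ℝ) / (p : ℝ)⌋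

lemma aux_sin_ne (P : ℕ) (hP : 0 < P) (k : ℤ) (hk : Odd k) :
    Real.sin (π * k / (2 * P)) ≠ 0 := by
  intro h
  rw [Real.sin_eq_zero_iff] at h
  obtain ⟨n, hn⟩ := h
  have hP' : (P : ℝ) ≠ 0 := by positivity
  have hpi := Real.pi_ne_zero
  have h1 : (k : ℝ) = 2 * P * n := by
    field_simp at hn
    linarith
  have h2 : k = 2 * P * n := by exact_mod_cast h1
  rw [h2] at hk
  exact (Int.not_odd_iff_even.mpr ⟨P * n, by ring⟩) hk

/-- Telescoping sum of cosines at odd multiples. -/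
lemma aux_cos_tele (θ : ℝ) (P : ℕ) :
    2 * Real.sin θ * ∑ j ∈ range P, Real.cos ((2 * j + 1) * θ) = Real.sin (2 * P * θ) := by
  induction P with
  | zero => simp
  | succ n ih =>
    rw [Finset.sum_range_succ, mul_add, ih]
    have e1 : 2 * ((n + 1 : ℕ) : ℝ) * θ = (2 * n + 1) * θ + θ := by push_cast; ring
    have e2 : 2 * (n : ℝ) * θ = (2 * n + 1) * θ - θ := by ring
    rw [e1, e2, Real.sin_add, Real.sin_sub]
    ring

lemma aux_C (P : ℕ) (m : ℕ) (h0 : 0 < m) (h1 : m < P) :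
    ∑ j ∈ range P, Real.cos ((2 * j + 1) * (π * m / P)) = 0 := by
  have hP : (0 : ℝ) < P := by exact_mod_cast h0.trans h1
  have hm : (0 : ℝ) < m := by exact_mod_cast h0
  have hs : 0 < Real.sin (π * m / P) := by
    apply Real.sin_pos_of_pos_of_lt_pi
    · positivity
    · rw [div_lt_iff₀ hP]
      have : (m : ℝ) < P := by exact_mod_cast h1
      exact mul_lt_mul_of_pos_left this Real.pi_pos
  have h := aux_cos_tele (π * m / P) P
  have e : 2 * (P : ℝ) * (π * m / P) = ((2 * m : ℕ) : ℝ) * π := by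
    push_cast
    field_simp
  rw [e, Real.sin_nat_mul_pi] at h
  rcases mul_eq_zero.mp h with h | h
  · linarith
  · exact h

noncomputable def auxF (P : ℕ) (m : ℤ) : ℝ :=
  ∑ j ∈ range P, Real.cot (π * (2 * j + 1 : ℤ) / (2 * P)) * Real.sin ((2 * j + 1) * (π * m / P))

lemma auxF_step (P : ℕ) (hP : 0 < P) (m : ℕ) :
    auxF P (m + 1 : ℕ) = auxF P m + ∑ j ∈ range P, Real.cos ((2 * j + 1) * (π * m / P))
      + ∑ j ∈ range P, Real.cos ((2 * j + 1) * (π * (m + 1 : ℕ) / P)) := by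
  unfold auxF
  rw [← Finset.sum_add_distrib, ← Finset.sum_add_distrib]
  refine Finset.sum_congr rfl fun j _ => ?_
  have hs := aux_sin_ne P hP (2 * j + 1) ⟨j, rfl⟩
  have hP' : (P : ℝ) ≠ 0 := by positivity
  set a := π * ((2 * j + 1 : ℤ) : ℝ) / (2 * P) with ha
  set x := (2 * (j : ℝ) + 1) * (π * m / P) with hx
  have e : (2 * (j : ℝ) + 1) * (π * ((m + 1 : ℕ) : ℝ) / P) = x + 2 * a := by
    rw [ha, hx]; push_cast; field_simp
  have e' : (2 * (j : ℝ) + 1) * (π * (((m + 1 : ℕ) : ℤ) : ℝ) / P) = x + 2 * a := by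
    rw [← e]; push_cast; ring
  have e'' : (2 * (j : ℝ) + 1) * (π * ((m : ℤ) : ℝ) / P) = x := by
    rw [hx]; push_cast; ring
  rw [e, e', e'', Real.cot_eq_cos_div_sin, Real.sin_add, Real.cos_add, Real.sin_two_mul,
    Real.cos_two_mul]
  field_simp
  have := Real.sin_sq_add_cos_sq a
  have h2 : Real.sin a ^ 2 = 1 - Real.cos a ^ 2 := by linarith
  ring_nf
  try rw [h2]
  try ring

lemma auxF_small (P : ℕ) (m : ℕ) (h1 : m + 1 < P) : auxF P (m + 1 : ℕ) = P := by
  induction m with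
  | zero =>
    rw [auxF_step P (by omega), aux_C P (0 + 1) (by omega) h1]
    simp [auxF]
  | succ n ih =>
    rw [auxF_step P (by omega), aux_C P (n + 1) (by omega) (by omega),
      aux_C P (n + 1 + 1) (by omega) h1, ih (by omega)]
    simp

lemma auxF_period (P : ℕ) (hP : 0 < P) (r t : ℤ) :
    auxF P (r + P * t) = (-1 : ℝ) ^ t * auxF P r := by
  unfold auxF
  rw [Finset.mul_sum]
  refine Finset.sum_congr rfl fun j _ => ?_
  have hP' : (P : ℝ) ≠ 0 := by positivity
  have e : (2 * (j : ℝ) + 1) * (π * ((r + P * t : ℤ) : ℝ) / P)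
      = (2 * (j : ℝ) + 1) * (π * r / P) + (((2 * j + 1) * t : ℤ) : ℝ) * π := by
    push_cast; field_simp
  rw [e, Real.sin_add_int_mul_pi, zpow_mul]
  have : (-1 : ℝ) ^ (2 * (j : ℤ) + 1) = -1 := Odd.neg_one_zpow ⟨j, rfl⟩
  rw [this]
  ring

lemma auxF_eq (P : ℕ) (hP : 0 < P) (m : ℤ) (hm : ¬ (P : ℤ) ∣ m) :
    auxF P m = P * (-1 : ℝ) ^ ⌊(m : ℝ) / (P : ℝ)⌋ := by
  have hfl : ⌊(m : ℝ) / (P : ℝ)⌋ = m / P := by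
    rw [Int.floor_div_natCast, Int.floor_intCast]
  rw [hfl]
  have h0 : m % P ≠ 0 := fun h => hm (Int.dvd_of_emod_eq_zero h)
  have h1 : 0 ≤ m % P := Int.emod_nonneg _ (by omega)
  have h2 : m % P < P := Int.emod_lt_of_pos _ (by omega)
  obtain ⟨r, hr⟩ : ∃ r : ℕ, m % P = ((r + 1 : ℕ) : ℤ) := ⟨(m % P - 1).toNat, by omega⟩
  have h3 := auxF_small P r (by omega)
  conv_lhs => rw [← Int.emod_add_mul_ediv m P]
  rw [auxF_period P hP, hr, h3]
  ring

lemma aux_sin_tele (b : ℝ) (P : ℕ) :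
    2 * Real.sin b * ∑ i ∈ range P, Real.sin (2 * b * (i + 1))
      = Real.cos b - Real.cos (2 * b * (P + 1) - b) := by
  induction P with
  | zero => simp; ring_nf
  | succ n ih =>
    rw [Finset.sum_range_succ, mul_add, ih]
    have e1 : 2 * b * (((n + 1 : ℕ) : ℝ) + 1) - b = 2 * b * (n + 1) + b := by push_cast; ring
    rw [e1, Real.cos_add, Real.cos_sub]
    ring

lemma aux_inner (P : ℕ) (hP : 0 < P) (k : ℤ) (hk : Odd k) :
    ∑ i ∈ range (P - 1), Real.sin (2 * (π * k / (2 * P)) * (i + 1))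
      = Real.cot (π * k / (2 * P)) := by
  have hs := aux_sin_ne P hP k hk
  have h := aux_sin_tele (π * k / (2 * P)) (P - 1)
  have hP' : (P : ℝ) ≠ 0 := by positivity
  have e : 2 * (π * k / (2 * P)) * (((P - 1 : ℕ) : ℝ) + 1) - π * k / (2 * P)
      = -(π * k / (2 * P)) + k * π := by
    rw [Nat.cast_sub hP]; push_cast; field_simp; ring
  rw [e, Real.cos_add_int_mul_pi, hk.neg_one_zpow, Real.cos_neg] at h
  rw [Real.cot_eq_cos_div_sin, eq_div_iff hs]
  linarith

theorem stmt_12 (q p : ℤ) (hp : 0 < p) (hco : IsCoprime q p) (hodd : Odd q) :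
    Sfun q p = (1 / (2 * (p : ℝ))) *
      ∑ k ∈ (Finset.Icc (1 : ℤ) (2 * p - 1)).filter (fun k => Odd k),
        Real.cot (π * k / (2 * p)) * Real.cot (π * k * q / (2 * p)) := by
  obtain ⟨P, rfl⟩ : ∃ P : ℕ, p = P := ⟨p.toNat, by omega⟩
  have hP : 0 < P := by omega
  have hP' : (P : ℝ) ≠ 0 := by positivity
  have s1 : ∀ f : ℤ → ℝ, ∑ n ∈ Finset.Icc (1 : ℤ) (P - 1), f n
      = ∑ i ∈ range (P - 1), f (i + 1) := by
    intro f
    refine Finset.sum_bij' (fun n _ => (n - 1).toNat) (fun i _ => (i : ℤ) + 1) ?_ ?_ ?_ ?_ ?_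
    · intro n hn; simp at hn ⊢; omega
    · intro n hn; simp at hn ⊢; omega
    · intro n hn; simp at hn ⊢; omega
    · intro n hn; simp
    · intro n hn; simp at hn; congr 1; omega
  have s2 : ∀ f : ℤ → ℝ, ∑ n ∈ (Finset.Icc (1 : ℤ) (2 * P - 1)).filter (fun k => Odd k), f n
      = ∑ j ∈ range P, f (2 * j + 1) := by
    intro f
    refine Finset.sum_bij' (fun n _ => (n / 2).toNat) (fun i _ => 2 * (i : ℤ) + 1) ?_ ?_ ?_ ?_ ?_
    · intro n hn; simp [Int.odd_iff] at hn ⊢; omega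
    · intro n hn; simp [Int.odd_iff] at hn ⊢; omega
    · intro n hn; simp [Int.odd_iff] at hn ⊢; omega
    · intro n hn; omega
    · intro n hn; simp [Int.odd_iff] at hn; congr 1; omega
  unfold Sfun
  rw [s1, s2]
  have key : ∀ i ∈ range (P - 1), (-1 : ℝ) ^ ⌊((((i : ℤ) + 1) * q : ℤ) : ℝ) / ((P : ℤ) : ℝ)⌋
      = (1 / P) * auxF P (((i : ℤ) + 1) * q) := by
    intro i hi
    rw [auxF_eq P hP]
    · rw [Int.cast_natCast]; field_simp
    · intro hd
      have h := hco.symm.dvd_of_dvd_mul_right hd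
      have := Int.le_of_dvd (by omega) h
      simp at hi
      omega
  rw [Finset.sum_congr rfl key, ← Finset.mul_sum]
  unfold auxF
  rw [Finset.sum_comm]
  have key2 : ∀ j ∈ range P, ∑ i ∈ range (P - 1),
      Real.cot (π * (2 * j + 1 : ℤ) / (2 * P)) *
        Real.sin ((2 * j + 1) * (π * ((((i : ℤ) + 1) * q : ℤ) : ℝ) / P))
      = Real.cot (π * (2 * j + 1 : ℤ) / (2 * (P : ℤ))) *
        Real.cot (π * (2 * j + 1 : ℤ) * q / (2 * (P : ℤ))) := by
    intro j _
    have h := aux_inner P hP ((2 * j + 1) * q) (Odd.mul ⟨j, rfl⟩ hodd)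
    have e : π * ((2 * j + 1 : ℤ) : ℝ) * q / (2 * ((P : ℤ) : ℝ))
        = π * (((2 * j + 1) * q : ℤ) : ℝ) / (2 * P) := by push_cast; ring
    rw [← Finset.mul_sum, e, ← h, Int.cast_natCast]
    congr 1
    refine Finset.sum_congr rfl fun i _ => ?_
    congr 1
    push_cast
    field_simp
  rw [Finset.sum_congr rfl key2, Int.cast_natCast]
  ring
end

section
/- Let 0 < q < p be coprime integers with q odd, let ζ = e^{iπq/p}, and let n ≥ 1 be an integer that is not a multiple of p. Then arg( (1+ζⁿ)/(1-ζⁿ) ) = (π/2) · (-1)^{⌊nq/p⌋}, where arg denotes the principal argument. -/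
open Real

/-- Let `0 < q < p` be coprime with `q` odd, `ζ = e^{iπq/p}`, and let
`n ≥ 1` not be a multiple of `p`. Then `arg((1+ζⁿ)/(1-ζⁿ)) = (π/2)·(-1)^{⌊nq/p⌋}`. -/
theorem stmt_14 (p q : ℕ) (h0 : 0 < q) (hqp : q < p) (hco : Nat.Coprime q p) (hodd : Odd q)
    (n : ℕ) (hn : 1 ≤ n) (hpn : ¬ p ∣ n) :
    Complex.arg ((1 + Complex.exp (π * q / p * Complex.I) ^ n) /
        (1 - Complex.exp (π * q / p * Complex.I) ^ n))
      = π / 2 * (-1 : ℝ) ^ ⌊((n * q : ℕ) : ℝ) / (p : ℝ)⌋ := by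
  have hp : (p : ℝ) ≠ 0 := by
    have : p ≠ 0 := by omega
    exact_mod_cast this
  set x : ℝ := ((n * q : ℕ) : ℝ) / (p : ℝ) with hx
  have hf : 0 < Int.fract x := by
    rcases (Int.fract_nonneg x).lt_or_eq with h | h
    · exact h
    · exfalso
      have h1 : x = (⌊x⌋ : ℝ) := by
        have := Int.floor_add_fract x
        rw [← h, add_zero] at this
        exact this.symm
      have h2 : ((n * q : ℕ) : ℝ) = (⌊x⌋ : ℝ) * p := by
        rw [← h1, hx]; field_simp
      have h3 : ((n * q : ℕ) : ℤ) = ⌊x⌋ * (p : ℤ) := by exact_mod_cast h2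
      have h4 : p ∣ n * q := by
        have : (p : ℤ) ∣ ((n * q : ℕ) : ℤ) := ⟨⌊x⌋, by rw [h3]; ring⟩
        exact_mod_cast this
      exact hpn (hco.symm.dvd_of_dvd_mul_right h4)
  have hf1 := Int.fract_lt_one x
  have hsf : 0 < sin (Int.fract x * π) :=
    sin_pos_of_pos_of_lt_pi (by positivity) (by nlinarith [pi_pos])
  have hs : sin (x * π) = (-1) ^ ⌊x⌋ * sin (Int.fract x * π) := by
    rw [← sin_add_int_mul_pi]
    congr 1
    nth_rewrite 1 [← Int.floor_add_fract x]
    ring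
  have hz : Complex.exp (π * q / p * Complex.I) ^ n
      = (cos (x * π) : ℂ) + (sin (x * π) : ℂ) * Complex.I := by
    rw [← Complex.exp_nat_mul, Complex.ofReal_cos, Complex.ofReal_sin, ← Complex.exp_mul_I]
    congr 1
    rw [hx]; push_cast; ring
  have hm : ((-1 : ℝ) ^ ⌊x⌋ = 1) ∨ ((-1 : ℝ) ^ ⌊x⌋ = -1) := by
    rcases Int.even_or_odd ⌊x⌋ with h | h
    · left; exact h.neg_one_zpow
    · right; exact h.neg_one_zpow
  have hs0 : sin (x * π) ≠ 0 := by
    rw [hs]; rcases hm with h | h <;> rw [h] <;> intro h' <;> linarith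
  have hc : 0 < 1 - cos (x * π) := by
    have h1 := sin_sq_add_cos_sq (x * π)
    have h2 : 0 < sin (x * π) ^ 2 := by positivity
    nlinarith
  have key : (1 + Complex.exp (π * q / p * Complex.I) ^ n) /
        (1 - Complex.exp (π * q / p * Complex.I) ^ n)
      = ((sin (x * π) / (1 - cos (x * π)) : ℝ) : ℂ) * Complex.I := by
    rw [hz]
    have h1 : (1 - ((cos (x * π) : ℂ) + (sin (x * π) : ℂ) * Complex.I)) ≠ 0 := by
      intro h
      have := congrArg Complex.re h
      simp [-Complex.ofReal_cos, -Complex.ofReal_sin] at this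
      linarith
    have h2 : (1 - (cos (x * π) : ℂ)) ≠ 0 := by
      have := hc.ne'
      exact_mod_cast this
    have h3 : (sin (x * π) : ℂ) ^ 2 + (cos (x * π) : ℂ) ^ 2 = 1 := by
      exact_mod_cast sin_sq_add_cos_sq (x * π)
    rw [div_eq_iff h1, Complex.ofReal_div, Complex.ofReal_sub, Complex.ofReal_one]
    generalize (cos (x * π) : ℂ) = c at *
    generalize (sin (x * π) : ℂ) = s at *
    field_simp
    linear_combination -h3 + s ^ 2 * Complex.I_sq
  rw [key]
  rcases hm with h | h
  · rw [h, one_mul] at hs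
    rw [Complex.arg_real_mul _ (div_pos (hs ▸ hsf) hc), Complex.arg_I, h, mul_one]
  · rw [h] at hs
    have : 0 < -sin (x * π) / (1 - cos (x * π)) := div_pos (by rw [hs]; linarith) hc
    have h5 : ((sin (x * π) / (1 - cos (x * π)) : ℝ) : ℂ) * Complex.I
        = ((-sin (x * π) / (1 - cos (x * π)) : ℝ) : ℂ) * (-Complex.I) := by
      rw [neg_div, Complex.ofReal_neg]; ring
    rw [h5, Complex.arg_real_mul _ this, Complex.arg_neg_I, h]
    ring
end

section
/- Let 0 < q < p be coprime odd integers, let ζ = e^{iπq/p}, and let k ∈ {1, …, p-1}. For t > 0 define F_k(t) := Σ_{n ≥ 1, n ≡ k (mod p)} arg( (1 + ζⁿ e^{-nt}) / (1 - ζⁿ e^{-nt}) ), where arg is the principal argument (each summand lies in (-π/2, π/2) and the series converges). Then lim_{t → 0⁺} F_k(t) = (π/4) · (-1)^{⌊kq/p⌋}. -/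
open Real Filter

lemma aux_arg (θ s : ℝ) (hs : 0 < s) (z : ℂ)
    (hz : z = Complex.exp (θ * Complex.I) * (Real.exp (-s) : ℂ)) :
    Complex.arg ((1 + z) / (1 - z)) = arctan (Real.sin θ / Real.sinh s) := by
  have hre : z.re = Real.cos θ * Real.exp (-s) := by
    rw [hz, Complex.re_mul_ofReal, Complex.exp_ofReal_mul_I_re]
  have him : z.im = Real.sin θ * Real.exp (-s) := by
    rw [hz, Complex.im_mul_ofReal, Complex.exp_ofReal_mul_I_im]
  have hr0 : 0 < Real.exp (-s) := Real.exp_pos _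
  have hr1 : Real.exp (-s) < 1 := by rw [Real.exp_lt_one_iff]; linarith
  have hsc := Real.sin_sq_add_cos_sq θ
  have hn : z.re ^ 2 + z.im ^ 2 = Real.exp (-s) ^ 2 := by
    rw [hre, him]; linear_combination Real.exp (-s) ^ 2 * hsc
  have hlt : 0 < 1 - (z.re ^ 2 + z.im ^ 2) := by rw [hn]; nlinarith
  have hN : 0 < Complex.normSq (1 - z) := by
    rw [Complex.normSq_pos]
    intro h
    have h1 : z = 1 := (sub_eq_zero.mp h).symm
    rw [h1] at hlt; norm_num at hlt
  have hwre : ((1 + z) / (1 - z)).re = (1 - (z.re ^ 2 + z.im ^ 2)) / Complex.normSq (1 - z) := by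
    rw [Complex.div_re]; simp; ring
  have hwim : ((1 + z) / (1 - z)).im = (2 * z.im) / Complex.normSq (1 - z) := by
    rw [Complex.div_im]; simp; ring
  have hpos : 0 < ((1 + z) / (1 - z)).re := by rw [hwre]; positivity
  have habs := Complex.abs_arg_lt_pi_div_two_iff.mpr (Or.inl hpos)
  rw [abs_lt] at habs
  rw [← Real.arctan_tan habs.1 habs.2, Complex.tan_arg, hwre, hwim]
  congr 1
  rw [div_div_div_cancel_right₀ hN.ne', hn, him, Real.sinh_eq]
  have he : Real.exp s = (Real.exp (-s))⁻¹ := by rw [Real.exp_neg, inv_inv]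
  rw [he]
  have h2 : 1 - Real.exp (-s) ^ 2 ≠ 0 := by nlinarith
  have h3 : (Real.exp (-s))⁻¹ - Real.exp (-s) = (1 - Real.exp (-s) ^ 2) / Real.exp (-s) := by
    field_simp
  rw [h3]
  field_simp

lemma aux_convex (c : ℝ) (hc : 0 < c) (hc1 : c ≤ 1) :
    ConvexOn ℝ (Set.Ioi 0) (fun s : ℝ => arctan (c / Real.sinh s)) := by
  have hd : ∀ s ∈ Set.Ioi (0:ℝ), HasDerivAt (fun s : ℝ => arctan (c / Real.sinh s))
      (-(c * Real.cosh s / (Real.sinh s ^ 2 + c ^ 2))) s := by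
    intro s hs
    have hs' : 0 < Real.sinh s := Real.sinh_pos_iff.mpr hs
    have h0 : HasDerivAt (fun s : ℝ => c / Real.sinh s)
        ((0 * Real.sinh s - c * Real.cosh s) / Real.sinh s ^ 2) s :=
      (hasDerivAt_const s c).div (Real.hasDerivAt_sinh s) hs'.ne'
    have h := h0.arctan
    convert h using 1
    have : Real.sinh s ^ 2 + c ^ 2 ≠ 0 := by positivity
    have : 1 + (c / Real.sinh s) ^ 2 ≠ 0 := by positivity
    field_simp
    ring
  apply MonotoneOn.convexOn_of_deriv (convex_Ioi 0)
  · intro s hs; exact (hd s hs).continuousAt.continuousWithinAt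
  · rw [interior_Ioi]; intro s hs; exact (hd s hs).differentiableAt.differentiableWithinAt
  · rw [interior_Ioi]
    intro x hx y hy hxy
    rw [(hd x hx).deriv, (hd y hy).deriv, neg_le_neg_iff]
    have hx0 : (0:ℝ) < x := hx
    have hy0 : (0:ℝ) < y := hy
    have hC : Real.cosh x ≤ Real.cosh y := by
      rw [Real.cosh_le_cosh, abs_of_pos hx0, abs_of_pos hy0]; exact hxy
    have h1 := Real.one_le_cosh x
    rw [div_le_div_iff₀ (by positivity) (by positivity), Real.sinh_sq, Real.sinh_sq, mul_assoc, mul_assoc]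
    apply mul_le_mul_of_nonneg_left _ hc.le
    have h2 : 0 ≤ 1 - c ^ 2 := by nlinarith
    nlinarith [mul_nonneg (sub_nonneg.mpr hC) h2,
      mul_nonneg (sub_nonneg.mpr hC) (mul_nonneg (by linarith : 0 ≤ Real.cosh x) (by linarith : 0 ≤ Real.cosh y))]

lemma aux_pairs (d : ℕ → ℝ) (hd : Summable d) (h : ∀ n, 0 ≤ d (2 * n) + d (2 * n + 1)) :
    0 ≤ ∑' n, d n := by
  have he : Summable (fun n => d (2 * n)) :=
    hd.comp_injective (i := fun n : ℕ => 2 * n) (fun x y h => by simpa using h)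
  have ho : Summable (fun n => d (2 * n + 1)) :=
    hd.comp_injective (i := fun n : ℕ => 2 * n + 1) (fun x y h => by simpa using h)
  rw [← tsum_even_add_odd he ho, ← he.tsum_add ho]
  exact tsum_nonneg h

lemma aux_arctan_le (x : ℝ) (hx : 0 ≤ x) : arctan x ≤ x := by
  have h := Real.le_tan (Real.arctan_nonneg.mpr hx) (Real.arctan_lt_pi_div_two x)
  rwa [Real.tan_arctan] at h

lemma aux_lower_s15 (a : ℕ → ℝ) (ha : Summable a) (hpos : ∀ n, 0 ≤ a n)
    (hconv : ∀ n, 2 * a (n + 1) ≤ a n + a (n + 2)) :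
    a 0 / 2 ≤ ∑' n, (-1 : ℝ) ^ n * a n := by
  have hS : Summable (fun n => (-1 : ℝ) ^ n * a n) := by
    apply Summable.of_norm_bounded ha
    intro n
    simp [abs_of_nonneg (hpos n)]
  have hS1 : Summable (fun n => (-1 : ℝ) ^ (n + 1) * a (n + 1)) := (summable_nat_add_iff 1).mpr hS
  have h1 : ∑' n, (-1 : ℝ) ^ n * a n = a 0 + ∑' n, (-1 : ℝ) ^ (n + 1) * a (n + 1) := by
    rw [hS.tsum_eq_zero_add]; simp
  have hD : Summable (fun n => (-1 : ℝ) ^ n * a n + (-1 : ℝ) ^ (n + 1) * a (n + 1)) := hS.add hS1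
  have h2 := hS.tsum_add hS1
  have h5 := aux_pairs _ hD (fun n => by
    have h := hconv (2 * n)
    have e1 : (-1 : ℝ) ^ (2 * n) = 1 := by simp
    have e2 : (-1 : ℝ) ^ (2 * n + 1) = -1 := by rw [pow_succ, e1]; norm_num
    have e3 : (-1 : ℝ) ^ (2 * n + 1 + 1) = 1 := by rw [pow_succ, e2]; norm_num
    rw [e1, e2, e3]
    have e4 : a (2 * n + 1 + 1) = a (2 * n + 2) := rfl
    rw [e4]
    linarith)
  linarith

lemma aux_upper (a : ℕ → ℝ) (ha : Summable a) (hpos : ∀ n, 0 ≤ a n)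
    (hconv : ∀ n, 2 * a (n + 1) ≤ a n + a (n + 2)) :
    ∑' n, (-1 : ℝ) ^ n * a n ≤ a 0 - a 1 / 2 := by
  have hS : Summable (fun n => (-1 : ℝ) ^ n * a n) := by
    apply Summable.of_norm_bounded ha
    intro n
    simp [abs_of_nonneg (hpos n)]
  have h := aux_lower_s15 (fun n => a (n + 1)) ((summable_nat_add_iff 1).mpr ha)
    (fun n => hpos _) (fun n => hconv _)
  rw [hS.tsum_eq_zero_add]
  have : ∀ n, (-1 : ℝ) ^ (n + 1) * a (n + 1) = -((-1 : ℝ) ^ n * a (n + 1)) := by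
    intro n; ring
  simp only [this, tsum_neg]
  simp at h ⊢
  linarith

lemma aux_summable (c k p t : ℝ) (hc : 0 < c) (hk : 0 < k) (hp : 0 < p) (ht : 0 < t) :
    Summable (fun m : ℕ => arctan (c / Real.sinh ((k + m * p) * t))) := by
  have hkt : 0 < k * t := by positivity
  have hpt : 0 < p * t := by positivity
  have hg : Summable (fun m : ℕ => c / Real.sinh (k * t) * Real.exp (-(p * t)) ^ m) :=
    (summable_geometric_of_lt_one (Real.exp_pos _).le
      (by rw [Real.exp_lt_one_iff]; linarith)).mul_left _
  have hsk : 0 < Real.sinh (k * t) := Real.sinh_pos_iff.mpr hkt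
  refine Summable.of_nonneg_of_le (fun m => ?_) (fun m => ?_) hg
  · rw [Real.arctan_nonneg]
    have : 0 < Real.sinh ((k + m * p) * t) := Real.sinh_pos_iff.mpr (by positivity)
    positivity
  · have hpos : 0 < Real.sinh ((k + m * p) * t) := Real.sinh_pos_iff.mpr (by positivity)
    have h1 : arctan (c / Real.sinh ((k + m * p) * t)) ≤ c / Real.sinh ((k + m * p) * t) :=
      aux_arctan_le _ (by positivity)
    refine h1.trans ?_
    have h2 : Real.sinh (k * t) * Real.exp (m * (p * t)) ≤ Real.sinh ((k + m * p) * t) := by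
      have e : (k + m * p) * t = k * t + m * (p * t) := by ring
      rw [e, Real.sinh_add, ← Real.cosh_add_sinh]
      have hh : 0 ≤ Real.sinh (m * (p * t)) := Real.sinh_nonneg_iff.mpr (by positivity)
      have := (Real.sinh_lt_cosh (k * t)).le
      nlinarith
    rw [← Real.exp_nat_mul, mul_neg, Real.exp_neg, ← div_eq_mul_inv, div_div]
    exact div_le_div_of_nonneg_left hc.le (by positivity) h2

lemma aux_lim (c k p : ℝ) (hc : 0 < c) (hc1 : c ≤ 1) (hk : 0 < k) (hp : 0 < p) :
    Tendsto (fun t : ℝ => ∑' m : ℕ, (-1 : ℝ) ^ m * arctan (c / Real.sinh ((k + m * p) * t)))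
      (nhdsWithin 0 (Set.Ioi 0)) (nhds (π / 4)) := by
  have hlim : ∀ b : ℝ, 0 < b → Tendsto (fun t : ℝ => arctan (c / Real.sinh (b * t)))
      (nhdsWithin 0 (Set.Ioi 0)) (nhds (π / 2)) := by
    intro b hb
    have h1 : Tendsto (fun t : ℝ => Real.sinh (b * t)) (nhdsWithin 0 (Set.Ioi 0))
        (nhdsWithin 0 (Set.Ioi 0)) := by
      apply tendsto_nhdsWithin_of_tendsto_nhds_of_eventually_within
      · have : Continuous (fun t : ℝ => Real.sinh (b * t)) := by fun_prop
        have h := this.tendsto 0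
        simp only [mul_zero, Real.sinh_zero] at h
        exact h.mono_left nhdsWithin_le_nhds
      · filter_upwards [self_mem_nhdsWithin] with t ht
        exact Real.sinh_pos_iff.mpr (mul_pos hb ht)
    have h2 : Tendsto (fun t : ℝ => c / Real.sinh (b * t)) (nhdsWithin 0 (Set.Ioi 0)) atTop := by
      simp only [div_eq_mul_inv]
      exact (tendsto_inv_nhdsGT_zero.comp h1).const_mul_atTop hc
    exact (Real.tendsto_arctan_atTop.mono_right nhdsWithin_le_nhds).comp h2
  have h0 := hlim k hk
  have h1 := hlim (k + p) (by positivity)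
  have hl : Tendsto (fun t : ℝ => arctan (c / Real.sinh (k * t)) / 2)
      (nhdsWithin 0 (Set.Ioi 0)) (nhds (π / 4)) := by
    convert h0.div_const 2 using 2; ring
  have hu : Tendsto (fun t : ℝ => arctan (c / Real.sinh (k * t)) - arctan (c / Real.sinh ((k + p) * t)) / 2)
      (nhdsWithin 0 (Set.Ioi 0)) (nhds (π / 4)) := by
    convert h0.sub (h1.div_const 2) using 2; ring
  have key : ∀ t : ℝ, 0 < t → (∀ n : ℕ, 0 ≤ arctan (c / Real.sinh ((k + n * p) * t))) ∧
      (∀ n : ℕ, 2 * arctan (c / Real.sinh ((k + (n + 1 : ℕ) * p) * t)) ≤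
        arctan (c / Real.sinh ((k + n * p) * t)) + arctan (c / Real.sinh ((k + (n + 2 : ℕ) * p) * t))) := by
    intro t ht
    refine ⟨fun n => ?_, fun n => ?_⟩
    · rw [Real.arctan_nonneg]
      have : 0 < Real.sinh ((k + n * p) * t) := Real.sinh_pos_iff.mpr (by positivity)
      positivity
    · have hx : (k + n * p) * t ∈ Set.Ioi (0 : ℝ) := by
        simp only [Set.mem_Ioi]; positivity
      have hy : (k + (n + 2 : ℕ) * p) * t ∈ Set.Ioi (0 : ℝ) := by
        simp only [Set.mem_Ioi]; positivity
      have h := (aux_convex c hc hc1).2 hx hy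
        (by norm_num : (0 : ℝ) ≤ 1 / 2) (by norm_num : (0 : ℝ) ≤ 1 / 2) (by norm_num)
      simp only [smul_eq_mul] at h
      have e : 1 / 2 * ((k + n * p) * t) + 1 / 2 * ((k + (n + 2 : ℕ) * p) * t) = (k + (n + 1 : ℕ) * p) * t := by
        push_cast; ring
      rw [e] at h
      linarith
  refine tendsto_of_tendsto_of_tendsto_of_le_of_le' hl hu ?_ ?_
  · filter_upwards [self_mem_nhdsWithin] with t ht
    have := aux_lower_s15 _ (aux_summable c k p t hc hk hp ht) (key t ht).1 (key t ht).2
    simpa using this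
  · filter_upwards [self_mem_nhdsWithin] with t ht
    have := aux_upper _ (aux_summable c k p t hc hk hp ht) (key t ht).1 (key t ht).2
    simpa using this

lemma aux_neg_one_mul_arctan (n : ℕ) (x : ℝ) : arctan ((-1) ^ n * x) = (-1) ^ n * arctan x := by
  rcases neg_one_pow_eq_or ℝ n with h | h <;> simp [h, Real.arctan_neg]

/-- Lemma 6.4. Let `0 < q < p` be coprime odd integers, `ζ = e^{iπq/p}`,
and `k ∈ {1,…,p-1}`. For `t > 0` set
`F_k(t) = Σ_{n ≥ 1, n ≡ k (mod p)} arg((1 + ζⁿ e^{-nt})/(1 - ζⁿ e^{-nt}))`.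
Then `F_k(t) → (π/4)·(-1)^{⌊kq/p⌋}` as `t → 0⁺`. -/
theorem stmt_15 (p q : ℕ) (hp : Odd p) (hq : Odd q) (h0 : 0 < q) (hqp : q < p)
    (hco : Nat.Coprime q p) (k : ℕ) (hk1 : 1 ≤ k) (hkp : k ≤ p - 1) :
    Tendsto (fun t : ℝ =>
        ∑' n : ℕ, if 1 ≤ n ∧ n % p = k % p then
          Complex.arg ((1 + Complex.exp (π * q / p * Complex.I) ^ n *
              (Real.exp (-(n : ℝ) * t) : ℂ)) /
            (1 - Complex.exp (π * q / p * Complex.I) ^ n *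
              (Real.exp (-(n : ℝ) * t) : ℂ)))
        else 0)
      (nhdsWithin 0 (Set.Ioi 0))
      (nhds (π / 4 * (-1 : ℝ) ^ ⌊((k * q : ℕ) : ℝ) / (p : ℝ)⌋)) := by
  have hp0 : 0 < p := by omega
  have hpR : (0 : ℝ) < p := by exact_mod_cast hp0
  have hkp' : k < p := by omega
  have hfl : ⌊((k * q : ℕ) : ℝ) / (p : ℝ)⌋ = ((k * q / p : ℕ) : ℤ) := by
    rw [Int.floor_eq_iff]
    have h1 := Nat.div_add_mod (k * q) p
    have h2 := Nat.mod_lt (k * q) hp0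
    constructor
    · rw [le_div_iff₀ hpR]
      have : k * q / p * p ≤ k * q := Nat.div_mul_le_self _ _
      exact_mod_cast this
    · rw [div_lt_iff₀ hpR]
      have : k * q < (k * q / p + 1) * p := by nlinarith
      exact_mod_cast this
  rw [hfl, zpow_natCast]
  set N := k * q / p with hN
  set r := k * q % p with hr
  have hr0 : 0 < r := by
    apply Nat.pos_of_ne_zero
    intro h
    have h1 : p ∣ k * q := Nat.dvd_of_mod_eq_zero h
    have h2 : p ∣ k := (Nat.Coprime.dvd_of_dvd_mul_right hco.symm h1)
    exact absurd (Nat.le_of_dvd (by omega) h2) (by omega)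
  have hrp : r < p := Nat.mod_lt _ hp0
  have hdm : p * N + r = k * q := Nat.div_add_mod _ _
  have hdmR : (p : ℝ) * N + r = k * q := by exact_mod_cast hdm
  have hrR : (0 : ℝ) < r := by exact_mod_cast hr0
  have hrpR : (r : ℝ) < p := by exact_mod_cast hrp
  set c := Real.sin (π * r / p) with hcdef
  have hc : 0 < c := by
    apply Real.sin_pos_of_pos_of_lt_pi
    · positivity
    · rw [div_lt_iff₀ hpR]; exact mul_lt_mul_of_pos_left hrpR Real.pi_pos
  have hc1 : c ≤ 1 := Real.sin_le_one _
  have hmain := (aux_lim c k p hc hc1 (by exact_mod_cast hk1) hpR).mul_const ((-1 : ℝ) ^ N)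
  refine hmain.congr' ?_
  filter_upwards [self_mem_nhdsWithin] with t ht
  have ht0 : 0 < t := ht
  have hinj : Function.Injective (fun m : ℕ => k + m * p) := by
    intro x y h
    have : x * p = y * p := by simpa using h
    exact Nat.eq_of_mul_eq_mul_right hp0 this
  rw [← tsum_mul_right]
  refine Eq.trans ?_ (hinj.tsum_eq ?_)
  · refine tsum_congr fun m => ?_
    have hcnd : 1 ≤ k + m * p ∧ (k + m * p) % p = k % p := ⟨by nlinarith, by simp⟩
    rw [if_pos hcnd]
    have hs : 0 < ((k + m * p : ℕ) : ℝ) * t := by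
      have : 0 < k + m * p := by nlinarith
      have : (0 : ℝ) < ((k + m * p : ℕ) : ℝ) := by exact_mod_cast this
      positivity
    rw [aux_arg (((k + m * p : ℕ) : ℝ) * (π * q / p)) _ hs _
      (by rw [← Complex.exp_nat_mul]; push_cast; ring_nf)]
    have hang : ((k + m * p : ℕ) : ℝ) * (π * q / p) = π * r / p + ((N + m * q : ℕ) : ℝ) * π := by
      push_cast
      field_simp
      linear_combination -hdmR
    rw [hang, Real.sin_add_nat_mul_pi, mul_div_assoc, aux_neg_one_mul_arctan, pow_add (-1 : ℝ) N (m * q),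
      mul_comm m q, pow_mul, hq.neg_one_pow]
    push_cast
    ring
  · intro n hn
    rw [Function.mem_support] at hn
    have hcond : 1 ≤ n ∧ n % p = k % p := by
      by_contra h
      exact hn (if_neg h)
    have h1 := hcond.2
    rw [Nat.mod_eq_of_lt hkp'] at h1
    refine ⟨n / p, ?_⟩
    have := Nat.div_add_mod n p
    simp only
    rw [mul_comm (n / p) p]; omega
end

section
/- Let p, q be coprime positive integers with q odd. Then S(q/(q+p)) - S(q/p) = 1/2. Consequently S(q/(2q+p)) - S(q/p) = 1. -/
open Real Finset

theorem fl_iff (q p n k : ℤ) (hp : 0 < p) :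
    ⌊((n * q : ℤ) : ℝ) / (p : ℝ)⌋ = k ↔ k * p ≤ n * q ∧ n * q < (k + 1) * p := by
  have hp' : (0 : ℝ) < p := by exact_mod_cast hp
  rw [Int.floor_eq_iff, le_div_iff₀ hp', div_lt_iff₀ hp']
  norm_cast

/-- `⌈kp/q⌉`. -/
def cA (q p k : ℤ) : ℤ := -((-(k * p)) / q)

theorem cA_le_iff (q p k n : ℤ) (hq : 0 < q) : cA q p k ≤ n ↔ k * p ≤ n * q := by
  unfold cA
  rw [neg_le, Int.le_ediv_iff_mul_le hq]
  constructor <;> intro h <;> linarith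

theorem cA_shift (q p k : ℤ) (hq : 0 < q) : cA q (q + p) k = cA q p k + k := by
  unfold cA
  have : -(k * (q + p)) = -(k * p) + (-k) * q := by ring
  rw [this, Int.add_mul_ediv_right _ _ hq.ne']
  ring

theorem cA_mono (q p k : ℤ) (hq : 0 < q) (hp : 0 < p) : cA q p k ≤ cA q p (k + 1) := by
  rw [cA_le_iff _ _ _ _ hq]
  have := (cA_le_iff q p (k + 1) _ hq).1 le_rfl
  linarith

theorem Sfun_eq (q p : ℤ) (hq : 0 < q) (hp : 0 < p) :
    Sfun q p = (1 / 2) * (∑ k ∈ Finset.Ico (0 : ℤ) q,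
      (-1 : ℝ) ^ k * ((cA q p (k + 1) - cA q p k : ℤ) : ℝ) - 1) := by
  unfold Sfun
  congr 1
  have h0 : Finset.Ico (0 : ℤ) p = insert 0 (Finset.Icc (1 : ℤ) (p - 1)) := by
    ext x
    simp only [Finset.mem_Ico, Finset.mem_insert, Finset.mem_Icc]
    omega
  have h1 : ∑ n ∈ Finset.Ico (0 : ℤ) p, (-1 : ℝ) ^ ⌊((n * q : ℤ) : ℝ) / (p : ℝ)⌋
      = 1 + ∑ n ∈ Finset.Icc (1 : ℤ) (p - 1), (-1 : ℝ) ^ ⌊((n * q : ℤ) : ℝ) / (p : ℝ)⌋ := by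
    rw [h0, Finset.sum_insert (by simp)]
    simp
  have hmaps : ∀ n ∈ Finset.Ico (0 : ℤ) p,
      ⌊((n * q : ℤ) : ℝ) / (p : ℝ)⌋ ∈ Finset.Ico (0 : ℤ) q := by
    intro n hn
    rw [Finset.mem_Ico] at hn ⊢
    obtain ⟨a, b⟩ := (fl_iff q p n _ hp).1 rfl
    generalize ⌊((n * q : ℤ) : ℝ) / (p : ℝ)⌋ = k at a b
    constructor
    · by_contra h
      have : k + 1 ≤ 0 := by omega
      nlinarith
    · by_contra h
      have : q ≤ k := by omega
      nlinarith
  rw [← Finset.sum_fiberwise_of_maps_to hmaps] at h1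
  rw [eq_sub_iff_add_eq, add_comm, ← h1]
  refine Finset.sum_congr rfl fun k hk => ?_
  rw [Finset.mem_Ico] at hk
  have hf : (Finset.Ico (0 : ℤ) p).filter (fun n => ⌊((n * q : ℤ) : ℝ) / (p : ℝ)⌋ = k)
      = Finset.Ico (cA q p k) (cA q p (k + 1)) := by
    ext n
    rw [Finset.mem_filter, fl_iff _ _ _ _ hp, Finset.mem_Ico, Finset.mem_Ico,
      cA_le_iff _ _ _ _ hq, ← not_le (a := cA q p (k + 1)), cA_le_iff _ _ _ _ hq, not_le]
    constructor
    · exact fun h => h.2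
    · rintro ⟨a, b⟩
      refine ⟨⟨?_, ?_⟩, a, b⟩
      · by_contra h
        have : n + 1 ≤ 0 := by omega
        nlinarith
      · by_contra h
        have h1 : p ≤ n := by omega
        have h2 : k + 1 ≤ q := by omega
        nlinarith
  have hc : ∀ n ∈ (Finset.Ico (0 : ℤ) p).filter (fun n => ⌊((n * q : ℤ) : ℝ) / (p : ℝ)⌋ = k),
      (-1 : ℝ) ^ ⌊((n * q : ℤ) : ℝ) / (p : ℝ)⌋ = (-1 : ℝ) ^ k := by
    intro n hn
    rw [(Finset.mem_filter.1 hn).2]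
  rw [Finset.sum_congr rfl hc, Finset.sum_const, hf, Int.card_Ico, nsmul_eq_mul, mul_comm]
  congr 1
  have := Int.toNat_of_nonneg (sub_nonneg.2 (cA_mono q p k hq hp))
  exact_mod_cast this

theorem alt_sum (m : ℕ) : ∑ k ∈ Finset.Ico (0 : ℤ) (2 * m + 1), (-1 : ℝ) ^ k = 1 := by
  induction m with
  | zero => 
    have : Finset.Ico (0 : ℤ) (2 * ((0 : ℕ) : ℤ) + 1) = {0} := by
      ext x; simp only [Finset.mem_Ico, Finset.mem_singleton]; omega
    rw [this]; simp
  | succ m ih =>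
    have : Finset.Ico (0 : ℤ) (2 * ((m + 1 : ℕ) : ℤ) + 1)
        = insert (2 * (m : ℤ) + 2) (insert (2 * (m : ℤ) + 1) (Finset.Ico (0 : ℤ) (2 * m + 1))) := by
      ext x; simp only [Finset.mem_Ico, Finset.mem_insert]; push_cast; omega
    rw [this, Finset.sum_insert (by simp), Finset.sum_insert (by simp), ih]
    have e1 : (-1 : ℝ) ^ (2 * (m : ℤ) + 2) = 1 := Even.neg_one_zpow ⟨m + 1, by ring⟩
    have e2 : (-1 : ℝ) ^ (2 * (m : ℤ) + 1) = -1 := Odd.neg_one_zpow ⟨m, by ring⟩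
    rw [e1, e2]; norm_num

theorem step (q p : ℤ) (hq : 0 < q) (hp : 0 < p) (hodd : Odd q) :
    Sfun q (q + p) - Sfun q p = 1 / 2 := by
  rw [Sfun_eq q p hq hp, Sfun_eq q (q + p) hq (by omega)]
  have : ∑ k ∈ Finset.Ico (0 : ℤ) q,
      (-1 : ℝ) ^ k * ((cA q (q + p) (k + 1) - cA q (q + p) k : ℤ) : ℝ)
      = ∑ k ∈ Finset.Ico (0 : ℤ) q, (-1 : ℝ) ^ k * ((cA q p (k + 1) - cA q p k : ℤ) : ℝ) + 1 := by
    obtain ⟨m, rfl⟩ := hodd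
    obtain ⟨m, rfl⟩ := Int.eq_ofNat_of_zero_le (show 0 ≤ m by omega)
    have ha := alt_sum m
    refine Eq.trans ?_ (congrArg _ ha)
    rw [← Finset.sum_add_distrib]
    refine Finset.sum_congr rfl fun k _ => ?_
    rw [cA_shift _ _ _ hq, cA_shift _ _ _ hq]
    push_cast
    ring
  rw [this]
  ring

/-- Proposition 6.7. For coprime positive integers `p, q` with `q` odd,
`S(q/(q+p)) - S(q/p) = 1/2`, and consequently `S(q/(2q+p)) - S(q/p) = 1`. -/
theorem stmt_16 (q p : ℤ) (hq : 0 < q) (hp : 0 < p) (hco : IsCoprime q p) (hodd : Odd q) :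
    Sfun q (q + p) - Sfun q p = 1 / 2 ∧ Sfun q (2 * q + p) - Sfun q p = 1 := by
  have h1 := step q p hq hp hodd
  refine ⟨h1, ?_⟩
  have h2 := step q (q + p) hq (by omega) hodd
  rw [show 2 * q + p = q + (q + p) by ring]
  linarith
end
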